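/- arXiv:1407.1426 — 4 statements merged into one kernel-verified Lean document; each statement's English description precedes it below -/
import Mathlib

section
/- Let d ≥ 1, fix x ∈ ℝ^d, a symmetric positive-definite d×d real matrix A, and b ∈ ℝ^d, and let f : ℝ^d → ℝ be four times continuously differentiable with f and all its partial derivatives up to order 4 bounded. Then there exist constants C₀ > 0 and ε₀ > 0 such that for all ε ∈ (0, ε₀]: | ε^{−d/2} ∫_{ℝ^d} exp(−(y−x−εb)ᵀA⁻¹(y−x−εb)/(2ε)) f(y) dy − (2π)^{d/2}(det A)^{1/2} · ( f(x) + ε·( ∑_i b_i ∂_i f(x) + ½ ∑_{i,j} A_{ij} ∂_i ∂_j f(x) ) ) | ≤ C₀ · ε². (This is the Euclidean case of the expansion of local kernels: the integral operator of the prototypical kernel expands as m(x)f(x) + ε·m(x)·𝓛f(x) + O(ε²) with zeroth moment m(x) = (2π)^{d/2}(det A)^{1/2}.) -/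
open MeasureTheory Matrix

/-- Partial derivative in the `i`-th coordinate direction. -/
noncomputable def pd {d : ℕ} (i : Fin d) (g : (Fin d → ℝ) → ℝ) (x : Fin d → ℝ) : ℝ :=
  fderiv ℝ g x (Pi.single i 1)

theorem gaussian_monomial_integrable (n : ℕ) :
    Integrable fun s : ℝ => s ^ n * Real.exp (-s ^ 2 / 2) := by
  have h := integrable_rpow_mul_exp_neg_mul_sq (b := 1 / 2) (by norm_num) (s := n)
    (by linarith [(n.cast_nonneg : (0 : ℝ) ≤ n)])
  refine h.congr (.of_forall fun s => ?_)
  simp only [Real.rpow_natCast]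
  ring_nf

theorem integral_exp_neg_sq_div_two :
    ∫ s : ℝ, Real.exp (-s ^ 2 / 2) = √(2 * Real.pi) := by
  rw [show 2 * Real.pi = Real.pi / (1 / 2) by ring, ← integral_gaussian]
  congr with s; ring_nf

theorem integral_id_mul_exp_neg_sq_div_two :
    ∫ s : ℝ, s * Real.exp (-s ^ 2 / 2) = 0 := by
  have h := integral_neg_eq_self (fun s : ℝ => s * Real.exp (-s ^ 2 / 2)) volume
  simp only [neg_sq, neg_mul, integral_neg] at h
  linarith

theorem integral_sq_mul_exp_neg_sq_div_two :
    ∫ s : ℝ, s ^ 2 * Real.exp (-s ^ 2 / 2) = √(2 * Real.pi) := by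
  have h := ProbabilityTheory.variance_id_gaussianReal (μ := 0) (v := 1)
  rw [ProbabilityTheory.variance_of_integral_eq_zero aemeasurable_id (by simp),
    ProbabilityTheory.integral_gaussianReal_eq_integral_smul one_ne_zero] at h
  have h0 : √(2 * Real.pi) ≠ 0 := by positivity
  have e : ∀ s : ℝ, ProbabilityTheory.gaussianPDFReal 0 1 s • (id s) ^ 2
      = (√(2 * Real.pi))⁻¹ * (s ^ 2 * Real.exp (-s ^ 2 / 2)) := by
    intro s; simp [ProbabilityTheory.gaussianPDFReal]; ring
  simp_rw [e, integral_const_mul] at h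
  field_simp at h
  simpa [neg_div] using h

theorem exists_mul_transpose_eq {d : ℕ} {A : Matrix (Fin d) (Fin d) ℝ} (hA : A.PosDef) :
    ∃ B : Matrix (Fin d) (Fin d) ℝ, A = B * Bᵀ ∧ B.det ≠ 0 ∧ |B.det| = √A.det := by
  open scoped MatrixOrder ComplexOrder in
  obtain ⟨B, hB⟩ := CStarAlgebra.nonneg_iff_eq_star_mul_self.mp hA.posSemidef.nonneg
  have hdet : A.det = B.det ^ 2 := by
    rw [hB, star_eq_conjTranspose, conjTranspose_eq_transpose_of_trivial, det_mul, det_transpose, sq]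
  refine ⟨Bᵀ, by simpa [star_eq_conjTranspose] using hB, fun h => ?_, ?_⟩
  · have := hA.det_pos
    rw [det_transpose] at h
    simp [hdet, h] at this
  · rw [hdet, Real.sqrt_sq_eq_abs, det_transpose]

/-- The symmetric second difference of a `C⁴` function agrees with its second derivative
up to a fourth-order error. -/
theorem abs_symmetric_second_difference_le {h : ℝ → ℝ} (hh : ContDiff ℝ 4 h) {K : ℝ}
    (hK : ∀ s, |iteratedDeriv 4 h s| ≤ K) :
    |h 1 + h (-1) - 2 * h 0 - iteratedDeriv 2 h 0| ≤ K := by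
  have key : ∀ g : ℝ → ℝ, ContDiff ℝ 4 g → ∃ c, g 1 =
      g 0 + deriv g 0 + iteratedDeriv 2 g 0 / 2 + iteratedDeriv 3 g 0 / 6
        + iteratedDeriv 4 g c / 24 := by
    intro g hg
    obtain ⟨c, -, hc⟩ := taylor_mean_remainder_lagrange_iteratedDeriv (n := 3) (zero_ne_one' ℝ)
      (f := g) (by norm_num; exact hg.contDiffOn)
    have hw : ∀ k : ℕ, k ≤ 4 → iteratedDerivWithin k g (Set.uIcc 0 1) 0 = iteratedDeriv k g 0 :=
      fun k hk => iteratedDerivWithin_eq_iteratedDeriv (uniqueDiffOn_uIcc (zero_ne_one' ℝ))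
        (hg.contDiffAt.of_le (by exact_mod_cast hk)) (by simp)
    refine ⟨c, ?_⟩
    simp only [taylorWithinEval_succ, taylor_within_zero_eval, zero_add] at hc
    rw [hw 1 (by norm_num), hw (1+1) (by norm_num), hw (2+1) (by norm_num)] at hc
    norm_num [Nat.factorial] at hc
    linarith
  obtain ⟨c, hc⟩ := key h hh
  obtain ⟨c', hc'⟩ := key (fun s => h (-s)) (hh.comp contDiff_neg)
  simp only [iteratedDeriv_comp_neg, deriv_comp_neg, neg_zero] at hc'
  norm_num at hc'
  have h1 := hK c
  have h2 := hK (-c')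
  rw [abs_le] at h1 h2 ⊢
  constructor <;> linarith [h1.1, h1.2, h2.1, h2.2]

theorem exists_abs_sub_le {h : ℝ → ℝ} (hh : ContDiff ℝ 1 h) :
    ∃ C, ∀ s ∈ Set.Icc (0 : ℝ) 1, |h s - h 0| ≤ C * s := by
  obtain ⟨C, hC⟩ := exists_taylor_mean_remainder_bound (n := 0) (zero_le_one' ℝ)
    (f := h) (by norm_num; exact hh.contDiffOn)
  exact ⟨C, fun s hs => by simpa using hC s hs⟩

theorem exists_abs_sub_sub_deriv_le {h : ℝ → ℝ} (hh : ContDiff ℝ 2 h) :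
    ∃ C, ∀ s ∈ Set.Icc (0 : ℝ) 1, |h s - h 0 - s * deriv h 0| ≤ C * s ^ 2 := by
  obtain ⟨C, hC⟩ := exists_taylor_mean_remainder_bound (n := 1) (zero_le_one' ℝ)
    (f := h) (by norm_num; exact hh.contDiffOn)
  refine ⟨C, fun s hs => ?_⟩
  have hw : iteratedDerivWithin 1 h (Set.Icc 0 1) 0 = iteratedDeriv 1 h 0 :=
    iteratedDerivWithin_eq_iteratedDeriv (uniqueDiffOn_Icc zero_lt_one)
        (hh.contDiffAt.of_le (by norm_num)) (by simp)
  have := hC s hs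
  simp only [taylorWithinEval_succ, taylor_within_zero_eval, zero_add, hw, iteratedDeriv_one] at this
  norm_num [sub_sub] at this ⊢
  exact this

/-- The unnormalised standard Gaussian density on `ℝ^d`. -/
noncomputable def gaussianWeight {d : ℕ} (u : Fin d → ℝ) : ℝ :=
  ∏ k, Real.exp (-u k ^ 2 / 2)

section GaussianWeight

variable {d : ℕ}

theorem gaussianWeight_eq_exp (u : Fin d → ℝ) :
    gaussianWeight u = Real.exp (-(u ⬝ᵥ u) / 2) := by
  rw [gaussianWeight, ← Real.exp_sum, ← Finset.sum_div, dotProduct, ← Finset.sum_neg_distrib]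
  simp_rw [sq]

theorem gaussianWeight_pos (u : Fin d → ℝ) : 0 < gaussianWeight u :=
  Finset.prod_pos fun _ _ => Real.exp_pos _

theorem gaussianWeight_neg (u : Fin d → ℝ) : gaussianWeight (-u) = gaussianWeight u := by
  simp [gaussianWeight]

theorem continuous_gaussianWeight : Continuous (gaussianWeight (d := d)) := by
  unfold gaussianWeight; fun_prop

theorem prod_pow_mul_gaussianWeight (a : Fin d → ℕ) (u : Fin d → ℝ) :
    (∏ k, u k ^ a k) * gaussianWeight u = ∏ k, (u k ^ a k * Real.exp (-u k ^ 2 / 2)) := by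
  rw [gaussianWeight, Finset.prod_mul_distrib]

theorem integrable_prod_pow_mul_gaussianWeight (a : Fin d → ℕ) :
    Integrable fun u : Fin d → ℝ => (∏ k, u k ^ a k) * gaussianWeight u := by
  simp_rw [prod_pow_mul_gaussianWeight]
  exact Integrable.fintype_prod (f := fun k s => s ^ a k * Real.exp (-s ^ 2 / 2))
    fun k => gaussian_monomial_integrable (a k)

theorem integral_prod_pow_mul_gaussianWeight (a : Fin d → ℕ) :
    ∫ u : Fin d → ℝ, (∏ k, u k ^ a k) * gaussianWeight u
      = ∏ k, ∫ s : ℝ, s ^ a k * Real.exp (-s ^ 2 / 2) := by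
  simp_rw [prod_pow_mul_gaussianWeight]
  exact integral_fintype_prod_volume_eq_prod (fun k (s : ℝ) => s ^ a k * Real.exp (-s ^ 2 / 2))

theorem integrable_gaussianWeight : Integrable (gaussianWeight (d := d)) := by
  simpa using integrable_prod_pow_mul_gaussianWeight (d := d) 0

theorem integral_gaussianWeight :
    ∫ u : Fin d → ℝ, gaussianWeight u = √(2 * Real.pi) ^ d := by
  simpa [integral_exp_neg_sq_div_two] using integral_prod_pow_mul_gaussianWeight (d := d) 0

theorem integrable_pow_mul_gaussianWeight (i : Fin d) (n : ℕ) :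
    Integrable fun u : Fin d → ℝ => u i ^ n * gaussianWeight u := by
  have h := integrable_prod_pow_mul_gaussianWeight (Pi.single i n)
  refine h.congr (.of_forall fun u => ?_)
  simp [Pi.single_apply, pow_ite]

theorem prod_pow_single_add_single (i j : Fin d) (u : Fin d → ℝ) :
    ∏ k, u k ^ (Pi.single i 1 + Pi.single j 1 : Fin d → ℕ) k = u i * u j := by
  simp only [Pi.add_apply, pow_add, Finset.prod_mul_distrib]
  simp [Pi.single_apply, pow_ite]

theorem integrable_mul_gaussianWeight (i j : Fin d) :
    Integrable fun u : Fin d → ℝ => u i * u j * gaussianWeight u := by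
  have h := integrable_prod_pow_mul_gaussianWeight (Pi.single i 1 + Pi.single j 1)
  simp_rw [prod_pow_single_add_single] at h
  exact h

theorem integral_mul_gaussianWeight (i j : Fin d) :
    ∫ u : Fin d → ℝ, u i * u j * gaussianWeight u
      = if i = j then √(2 * Real.pi) ^ d else 0 := by
  have h := integral_prod_pow_mul_gaussianWeight (Pi.single i 1 + Pi.single j 1)
  simp only [prod_pow_single_add_single] at h
  rw [h]
  split_ifs with hij
  · subst hij
    have : ∀ k, ∫ s : ℝ, s ^ (Pi.single i 1 + Pi.single i 1 : Fin d → ℕ) k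
        * Real.exp (-s ^ 2 / 2) = √(2 * Real.pi) := by
      intro k
      by_cases hk : k = i
      · subst hk; simp [integral_sq_mul_exp_neg_sq_div_two, -Nat.reduceAdd, one_add_one_eq_two]
      · simp [hk, integral_exp_neg_sq_div_two]
    rw [Finset.prod_congr rfl fun k _ => this k]; simp
  · refine Finset.prod_eq_zero (Finset.mem_univ i) ?_
    simp [hij, integral_id_mul_exp_neg_sq_div_two]

theorem integrable_norm_pow_four_mul_gaussianWeight :
    Integrable fun u : Fin d → ℝ => ‖u‖ ^ 4 * gaussianWeight u := by
  have h : Integrable fun u : Fin d → ℝ => ∑ i, u i ^ 4 * gaussianWeight u :=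
    integrable_finsetSum _ fun i _ => integrable_pow_mul_gaussianWeight i 4
  refine h.mono' (by have := continuous_gaussianWeight (d := d); fun_prop) (.of_forall fun u => ?_)
  rw [Real.norm_of_nonneg (mul_nonneg (by positivity) (gaussianWeight_pos u).le),
    ← Finset.sum_mul]
  refine mul_le_mul_of_nonneg_right ?_ (gaussianWeight_pos u).le
  have hS : 0 ≤ ∑ i, u i ^ 4 := Finset.sum_nonneg fun i _ => by positivity
  have hu : ‖u‖ ≤ √√(∑ i, u i ^ 4) := by
    refine (pi_norm_le_iff_of_nonneg (Real.sqrt_nonneg _)).2 fun i => ?_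
    refine Real.le_sqrt_of_sq_le (Real.le_sqrt_of_sq_le ?_)
    calc (‖u i‖ ^ 2) ^ 2 = u i ^ 4 := by rw [Real.norm_eq_abs, sq_abs]; ring
      _ ≤ _ := Finset.single_le_sum (f := fun i => u i ^ 4) (fun i _ => by positivity)
          (Finset.mem_univ i)
  calc ‖u‖ ^ 4 ≤ √√(∑ i, u i ^ 4) ^ 4 := by gcongr
    _ = (√√(∑ i, u i ^ 4) ^ 2) ^ 2 := by ring
    _ = _ := by rw [Real.sq_sqrt (Real.sqrt_nonneg _), Real.sq_sqrt hS]

theorem mulVec_mul_mulVec_mul_gaussianWeight (B : Matrix (Fin d) (Fin d) ℝ) (i j : Fin d)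
    (u : Fin d → ℝ) : (B *ᵥ u) i * (B *ᵥ u) j * gaussianWeight u
      = ∑ k, ∑ l, B i k * B j l * (u k * u l * gaussianWeight u) := by
  simp only [mulVec, dotProduct]
  rw [Finset.sum_mul_sum]
  simp_rw [Finset.sum_mul]
  refine Finset.sum_congr rfl fun k _ => Finset.sum_congr rfl fun l _ => by ring

theorem integrable_mulVec_mul_gaussianWeight (B : Matrix (Fin d) (Fin d) ℝ) (i j : Fin d) :
    Integrable fun u => (B *ᵥ u) i * (B *ᵥ u) j * gaussianWeight u := by
  simp_rw [mulVec_mul_mulVec_mul_gaussianWeight]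
  exact integrable_finsetSum _ fun k _ => integrable_finsetSum _ fun l _ =>
    (integrable_mul_gaussianWeight k l).const_mul _

theorem integral_mulVec_mul_gaussianWeight (B : Matrix (Fin d) (Fin d) ℝ) (i j : Fin d) :
    ∫ u, (B *ᵥ u) i * (B *ᵥ u) j * gaussianWeight u
      = √(2 * Real.pi) ^ d * (B * Bᵀ) i j := by
  simp_rw [mulVec_mul_mulVec_mul_gaussianWeight]
  rw [integral_finsetSum _ fun k _ => integrable_finsetSum _ fun l _ =>
    (integrable_mul_gaussianWeight k l).const_mul _]
  simp_rw [integral_finsetSum _ fun l _ => (integrable_mul_gaussianWeight _ l).const_mul _,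
    integral_const_mul, integral_mul_gaussianWeight]
  simp [mul_apply, Finset.mul_sum, mul_comm]

end GaussianWeight

section Directional

variable {d : ℕ}

theorem contDiff_pd {m n : WithTop ℕ∞} {g : (Fin d → ℝ) → ℝ} (hg : ContDiff ℝ n g)
    (hmn : m + 1 ≤ n) (i : Fin d) : ContDiff ℝ m (pd i g) :=
  (hg.fderiv_right hmn).clm_apply contDiff_const

theorem hasDerivAt_comp_line {g : (Fin d → ℝ) → ℝ} (hg : Differentiable ℝ g)
    (z v : Fin d → ℝ) (s : ℝ) :
    HasDerivAt (fun s : ℝ => g (z + s • v)) (∑ i, v i * pd i g (z + s • v)) s := by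
  have hl : HasDerivAt (fun s : ℝ => z + s • v) v s := by
    simpa using ((hasDerivAt_id s).smul_const v).const_add z
  have h := (hg (z + s • v)).hasFDerivAt.comp_hasDerivAt s hl
  have e : ∑ i, v i * pd i g (z + s • v) = fderiv ℝ g (z + s • v) v := by
    simp only [pd]
    generalize fderiv ℝ g (z + s • v) = D
    conv_rhs => rw [pi_eq_sum_univ' v]
    simp [map_sum]
  rw [e]
  exact h

theorem iteratedDeriv_two_comp_line {f : (Fin d → ℝ) → ℝ} (hf : ContDiff ℝ 2 f)
    (z v : Fin d → ℝ) :
    iteratedDeriv 2 (fun s : ℝ => f (z + s • v)) 0 = ∑ i, ∑ j, v i * v j * pd i (pd j f) z := by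
  rw [iteratedDeriv_succ, iteratedDeriv_one]
  have h1 : deriv (fun s : ℝ => f (z + s • v)) = fun s => ∑ j, v j * pd j f (z + s • v) :=
    funext fun s => (hasDerivAt_comp_line (hf.differentiable (by norm_num)) z v s).deriv
  have h2 : HasDerivAt (fun s : ℝ => ∑ j, v j * pd j f (z + s • v))
      (∑ j, v j * ∑ i, v i * pd i (pd j f) (z + (0 : ℝ) • v)) 0 :=
    HasDerivAt.fun_sum fun j _ => (hasDerivAt_comp_line
      ((contDiff_pd (m := 1) hf (by norm_num [one_add_one_eq_two]) j).differentiable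
        one_ne_zero) z v 0).const_mul _
  rw [h1, h2.deriv]
  simp_rw [Finset.mul_sum, zero_smul, add_zero]
  rw [Finset.sum_comm]
  refine Finset.sum_congr rfl fun k _ => Finset.sum_congr rfl fun l _ => by ring

theorem abs_iteratedDeriv_comp_line_le {f : (Fin d → ℝ) → ℝ} {n : ℕ} (hf : ContDiff ℝ n f)
    {M : ℝ} (hM : ∀ y, ‖iteratedFDeriv ℝ n f y‖ ≤ M) (z v : Fin d → ℝ) (s : ℝ) :
    |iteratedDeriv n (fun s : ℝ => f (z + s • v)) s| ≤ M * ‖v‖ ^ n := by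
  let L : ℝ →L[ℝ] (Fin d → ℝ) := (ContinuousLinearMap.id ℝ ℝ).smulRight v
  have h := L.iteratedFDeriv_comp_right (f := fun y => f (z + y)) (i := n)
    (hf.comp (contDiff_const.add contDiff_id)) s le_rfl
  rw [← Real.norm_eq_abs, ← norm_iteratedFDeriv_eq_norm_iteratedDeriv]
  change ‖iteratedFDeriv ℝ n ((fun y => f (z + y)) ∘ L) s‖ ≤ _
  rw [h, iteratedFDeriv_comp_add_left]
  refine (ContinuousMultilinearMap.norm_compContinuousLinearMap_le _ _).trans ?_
  have hL : ‖L‖ = ‖v‖ := by simp [L]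
  simp only [hL, Finset.prod_const, Finset.card_univ, Fintype.card_fin]
  gcongr
  exact hM _

end Directional

section Expansion

variable {d : ℕ}

theorem integrable_gaussianWeight_mul {f : (Fin d → ℝ) → ℝ} (hf : Continuous f) {M : ℝ}
    (hM : ∀ y, |f y| ≤ M) (B : Matrix (Fin d) (Fin d) ℝ) (z : Fin d → ℝ) (t : ℝ) :
    Integrable fun u => f (z + t • (B *ᵥ u)) * gaussianWeight u := by
  refine integrable_gaussianWeight.bdd_mul (c := M) ?_ (.of_forall fun u => by simpa using hM _)
  have : Continuous fun u : Fin d → ℝ => B *ᵥ u := by fun_prop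
  exact Continuous.aestronglyMeasurable (by fun_prop)

/-- Second-order expansion of a Gaussian average around its centre `z`, uniform in `z`. -/
theorem exists_gaussian_average_expansion {f : (Fin d → ℝ) → ℝ} (hf : ContDiff ℝ 4 f) {M₀ M₄ : ℝ}
    (hM₀ : ∀ y, |f y| ≤ M₀) (hM₄ : ∀ y, ‖iteratedFDeriv ℝ 4 f y‖ ≤ M₄)
    (B : Matrix (Fin d) (Fin d) ℝ) :
    ∃ K, ∀ (z : Fin d → ℝ) (t : ℝ),
      |(∫ u, f (z + t • (B *ᵥ u)) * gaussianWeight u) - √(2 * Real.pi) ^ d *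
        (f z + t ^ 2 * (1 / 2 * ∑ i, ∑ j, (B * Bᵀ) i j * pd i (pd j f) z))| ≤ K * t ^ 4 := by
  set L := B.mulVecLin.toContinuousLinearMap
  have hLB : ∀ u, ‖B *ᵥ u‖ ≤ ‖L‖ * ‖u‖ := fun u => L.le_opNorm u
  refine ⟨M₄ * ‖L‖ ^ 4 * (∫ u : Fin d → ℝ, ‖u‖ ^ 4 * gaussianWeight u) / 2, fun z t => ?_⟩
  have hM₄0 : 0 ≤ M₄ := (norm_nonneg _).trans (hM₄ 0)
  have hp := integrable_gaussianWeight_mul hf.continuous hM₀ B z t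
  have hn := integrable_gaussianWeight_mul hf.continuous hM₀ B z (-t)
  have heq : ∫ u, f (z + -t • (B *ᵥ u)) * gaussianWeight u
      = ∫ u, f (z + t • (B *ᵥ u)) * gaussianWeight u := by
    rw [← integral_neg_eq_self]
    simp [gaussianWeight_neg, mulVec_neg]
  let Q : (Fin d → ℝ) → ℝ := fun u =>
    ∑ i, ∑ j, pd i (pd j f) z * ((B *ᵥ u) i * (B *ᵥ u) j * gaussianWeight u)
  have hQ : Integrable Q := integrable_finsetSum _ fun i _ => integrable_finsetSum _ fun j _ =>
    (integrable_mulVec_mul_gaussianWeight B i j).const_mul _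
  have hQint : ∫ u, Q u = √(2 * Real.pi) ^ d * ∑ i, ∑ j, (B * Bᵀ) i j * pd i (pd j f) z := by
    simp only [Q]
    rw [integral_finsetSum _ fun i _ => integrable_finsetSum _ fun j _ =>
      (integrable_mulVec_mul_gaussianWeight B i j).const_mul _]
    simp_rw [integral_finsetSum _ fun j _ =>
      (integrable_mulVec_mul_gaussianWeight B _ j).const_mul _, integral_const_mul,
      integral_mulVec_mul_gaussianWeight, Finset.mul_sum]
    exact Finset.sum_congr rfl fun i _ => Finset.sum_congr rfl fun j _ => by ring
  have hbound : ∀ u, ‖f (z + t • (B *ᵥ u)) * gaussianWeight u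
      + f (z + -t • (B *ᵥ u)) * gaussianWeight u - 2 * f z * gaussianWeight u - t ^ 2 * Q u‖
      ≤ M₄ * ‖L‖ ^ 4 * t ^ 4 * (‖u‖ ^ 4 * gaussianWeight u) := by
    intro u
    have hw := gaussianWeight_pos u
    have h := abs_symmetric_second_difference_le
      (h := fun s : ℝ => f (z + s • (t • (B *ᵥ u)))) (hf.comp (by fun_prop))
      (abs_iteratedDeriv_comp_line_le (n := 4) hf hM₄ z (t • (B *ᵥ u)))
    rw [iteratedDeriv_two_comp_line (hf.of_le (by norm_num))] at h
    simp only [one_smul, neg_smul, zero_smul, add_zero] at h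
    have e : f (z + t • (B *ᵥ u)) * gaussianWeight u
        + f (z + -t • (B *ᵥ u)) * gaussianWeight u - 2 * f z * gaussianWeight u - t ^ 2 * Q u
        = (f (z + t • (B *ᵥ u)) + f (z + -(t • (B *ᵥ u))) - 2 * f z
          - ∑ i, ∑ j, (t • (B *ᵥ u)) i * (t • (B *ᵥ u)) j * pd i (pd j f) z)
          * gaussianWeight u := by
      have : t ^ 2 * Q u = (∑ i, ∑ j, (t • (B *ᵥ u)) i * (t • (B *ᵥ u)) j * pd i (pd j f) z)
          * gaussianWeight u := by
        simp only [Q, Finset.mul_sum, Finset.sum_mul, Pi.smul_apply, smul_eq_mul]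
        exact Finset.sum_congr rfl fun i _ => Finset.sum_congr rfl fun j _ => by ring
      rw [this, neg_smul]
      ring
    rw [e, Real.norm_eq_abs, abs_mul, abs_of_pos hw]
    calc _ ≤ M₄ * ‖t • (B *ᵥ u)‖ ^ 4 * gaussianWeight u := by gcongr
      _ ≤ M₄ * (|t| * (‖L‖ * ‖u‖)) ^ 4 * gaussianWeight u := by
        rw [norm_smul, Real.norm_eq_abs]; gcongr; exact hLB u
      _ = M₄ * ‖L‖ ^ 4 * |t| ^ 4 * (‖u‖ ^ 4 * gaussianWeight u) := by ring
      _ = _ := by rw [Even.pow_abs ⟨2, rfl⟩]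
  have hint := norm_integral_le_of_norm_le
    (integrable_norm_pow_four_mul_gaussianWeight.const_mul _) (.of_forall hbound)
  have hw := (integrable_gaussianWeight (d := d)).const_mul (2 * f z)
  have hpn : Integrable fun u => f (z + t • (B *ᵥ u)) * gaussianWeight u
      + f (z + -t • (B *ᵥ u)) * gaussianWeight u := hp.add hn
  have hpnw : Integrable fun u => f (z + t • (B *ᵥ u)) * gaussianWeight u
      + f (z + -t • (B *ᵥ u)) * gaussianWeight u - 2 * f z * gaussianWeight u := hpn.sub hw
  rw [integral_sub hpnw (hQ.const_mul _), integral_sub hpn hw, integral_add hp hn, heq,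
    integral_const_mul, integral_const_mul, integral_const_mul, hQint, integral_gaussianWeight,
    Real.norm_eq_abs] at hint
  rw [abs_le] at hint ⊢
  constructor <;> linarith [hint.1, hint.2]

theorem dotProduct_inv_mul_transpose_mulVec {B : Matrix (Fin d) (Fin d) ℝ} (hB : B.det ≠ 0)
    (u : Fin d → ℝ) : (B *ᵥ u) ⬝ᵥ ((B * Bᵀ)⁻¹ *ᵥ (B *ᵥ u)) = u ⬝ᵥ u := by
  have hu : IsUnit B.det := hB.isUnit
  have hut : IsUnit Bᵀ.det := by rwa [det_transpose]
  rw [Matrix.mul_inv_rev, mulVec_mulVec, Matrix.mul_assoc, nonsing_inv_mul _ hu, Matrix.mul_one,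
    dotProduct_mulVec, ← vecMul_transpose, vecMul_vecMul, mul_nonsing_inv _ hut, vecMul_one]

theorem integral_comp_mulVec {B : Matrix (Fin d) (Fin d) ℝ} (hB : B.det ≠ 0)
    {g : (Fin d → ℝ) → ℝ} (hg : Continuous g) :
    ∫ y, g y = |B.det| * ∫ u, g (B *ᵥ u) := by
  have h := integral_map (μ := volume) (φ := toLin' B) (f := g)
    (by fun_prop) hg.aestronglyMeasurable
  rw [Real.map_matrix_volume_pi_eq_smul_volume_pi hB, integral_smul_measure,
    ENNReal.toReal_ofReal (abs_nonneg _), smul_eq_mul, abs_inv] at h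
  have h0 : |B.det| ≠ 0 := abs_ne_zero.2 hB
  simp only [toLin'_apply] at h
  rw [← h, mul_inv_cancel_left₀ h0]

/-- Rescaling the prototypical kernel to the standard Gaussian weight. -/
theorem integral_prototypical_kernel {B : Matrix (Fin d) (Fin d) ℝ} (hB : B.det ≠ 0)
    {f : (Fin d → ℝ) → ℝ} (hf : Continuous f) (x b : Fin d → ℝ) {ε : ℝ} (hε : 0 < ε) :
    ε ^ (-(d : ℝ) / 2) * (∫ y : Fin d → ℝ,
        Real.exp (-((y - x - ε • b) ⬝ᵥ ((B * Bᵀ)⁻¹ *ᵥ (y - x - ε • b))) / (2 * ε)) * f y)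
      = |B.det| * ∫ u, f (x + ε • b + √ε • (B *ᵥ u)) * gaussianWeight u := by
  have hdet : (√ε • B).det ≠ 0 := by
    rw [det_smul]; exact mul_ne_zero (by positivity) hB
  have hpow : ε ^ (-(d : ℝ) / 2) * √ε ^ d = 1 := by
    rw [Real.sqrt_eq_rpow, ← Real.rpow_mul_natCast hε.le, ← Real.rpow_add hε]
    ring_nf
    simp
  rw [← integral_add_left_eq_self _ (x + ε • b), integral_comp_mulVec hdet, det_smul, abs_mul,
    Fintype.card_fin, abs_of_nonneg (by positivity : 0 ≤ √ε ^ d)]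
  · rw [show ∀ p q r s : ℝ, p * (q * r * s) = p * q * (r * s) by intros; ring, hpow, one_mul]
    congr 2 with u
    have e : x + ε • b + (√ε • B) *ᵥ u - x - ε • b = √ε • (B *ᵥ u) := by
      rw [smul_mulVec]; abel
    rw [e, mulVec_smul, smul_dotProduct, dotProduct_smul, dotProduct_inv_mul_transpose_mulVec hB,
      smul_mulVec, mul_comm, gaussianWeight_eq_exp, smul_eq_mul, smul_eq_mul, ← mul_assoc,
      Real.mul_self_sqrt hε.le]
    congr 2
    field_simp
  · fun_prop

end Expansion

/-- Expansion of the prototypical local kernel (Euclidean case): the integral operator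
expands as `m·f(x) + ε·m·𝓛f(x) + O(ε²)`, where `m = (2π)^(d/2)(det A)^(1/2)` and
`𝓛f = ∑ bᵢ ∂ᵢf + ½ ∑ Aᵢⱼ ∂ᵢ∂ⱼf`. -/
theorem prototypical_kernel_expansion
    (d : ℕ) (hd : 1 ≤ d) (x : Fin d → ℝ)
    (A : Matrix (Fin d) (Fin d) ℝ) (hA : A.PosDef) (b : Fin d → ℝ)
    (f : (Fin d → ℝ) → ℝ) (hf : ContDiff ℝ 4 f)
    (hbdd : ∀ k : ℕ, k ≤ 4 → ∃ M : ℝ, ∀ y, ‖iteratedFDeriv ℝ k f y‖ ≤ M) :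
    ∃ C₀ : ℝ, 0 < C₀ ∧ ∃ ε₀ : ℝ, 0 < ε₀ ∧ ∀ ε : ℝ, 0 < ε → ε ≤ ε₀ →
      |ε ^ (-(d : ℝ) / 2) *
          (∫ y : Fin d → ℝ,
            Real.exp (-((y - x - ε • b) ⬝ᵥ (A⁻¹ *ᵥ (y - x - ε • b))) / (2 * ε)) * f y)
        - (2 * Real.pi) ^ ((d : ℝ) / 2) * Real.sqrt A.det *
            (f x + ε * ((∑ i, b i * pd i f x) +
              (1 / 2) * ∑ i, ∑ j, A i j * pd i (pd j f) x))|
      ≤ C₀ * ε ^ 2 := by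
  obtain ⟨B, rfl, hB, hdet⟩ := exists_mul_transpose_eq hA
  obtain ⟨M₀, hM₀⟩ := hbdd 0 (by norm_num)
  obtain ⟨M₄, hM₄⟩ := hbdd 4 le_rfl
  simp only [norm_iteratedFDeriv_zero, Real.norm_eq_abs] at hM₀
  obtain ⟨K, hK⟩ := exists_gaussian_average_expansion hf hM₀ hM₄ B
  have hline : ContDiff ℝ 4 fun s : ℝ => x + s • b := by fun_prop
  obtain ⟨C₁, hC₁⟩ := exists_abs_sub_sub_deriv_le (h := fun s : ℝ => f (x + s • b))
    ((hf.comp hline).of_le (by norm_num))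
  have hpd : ∀ i j, ContDiff ℝ 1 (pd i (pd j f)) := fun i j =>
    contDiff_pd (contDiff_pd (m := 2) hf (by norm_num) j) (by norm_num) i
  obtain ⟨C₂, hC₂⟩ := exists_abs_sub_le
    (h := fun s : ℝ => 1 / 2 * ∑ i, ∑ j, (B * Bᵀ) i j * pd i (pd j f) (x + s • b)) <| by
      refine contDiff_const.mul (ContDiff.sum fun i _ => ContDiff.sum fun j _ =>
        contDiff_const.mul ((hpd i j).comp (hline.of_le (by norm_num))))
  rw [(hasDerivAt_comp_line (hf.differentiable (by norm_num)) x b 0).deriv] at hC₁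
  simp only [zero_smul, add_zero] at hC₁ hC₂
  set m := √(2 * Real.pi) ^ d with hm
  have hm0 : 0 ≤ m := by positivity
  have hconst : (2 * Real.pi) ^ ((d : ℝ) / 2) = m := by
    rw [hm, Real.sqrt_eq_rpow, ← Real.rpow_mul_natCast (by positivity)]
    ring_nf
  set D := |B.det|
  have hD0 : 0 ≤ D := abs_nonneg _
  refine ⟨|D * (K + m * (C₁ + C₂))| + 1, by positivity, 1, one_pos, fun ε hε hε1 => ?_⟩
  have hs : ε ∈ Set.Icc (0 : ℝ) 1 := ⟨hε.le, hε1⟩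
  rw [integral_prototypical_kernel hB hf.continuous x b hε, hconst, ← hdet]
  have h0 := hK (x + ε • b) √ε
  have h4 : √ε ^ 4 = ε ^ 2 := by
    rw [show √ε ^ 4 = (√ε ^ 2) ^ 2 by ring, Real.sq_sqrt hε.le]
  rw [Real.sq_sqrt hε.le, h4] at h0
  have h1 := hC₁ ε hs
  have h2 := hC₂ ε hs
  set I := ∫ u, f (x + ε • b + √ε • (B *ᵥ u)) * gaussianWeight u
  set P := 1 / 2 * ∑ i, ∑ j, (B * Bᵀ) i j * pd i (pd j f) (x + ε • b)
  set P₀ := 1 / 2 * ∑ i, ∑ j, (B * Bᵀ) i j * pd i (pd j f) x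
  set N := ∑ i, b i * pd i f x
  calc |D * I - m * D * (f x + ε * (N + P₀))|
      = D * |(I - m * (f (x + ε • b) + ε * P))
          + m * ((f (x + ε • b) - f x - ε * N) + ε * (P - P₀))| := by
        rw [← abs_of_nonneg hD0, ← abs_mul, abs_of_nonneg hD0]
        congr 1
        ring
    _ ≤ D * (K * ε ^ 2 + m * (C₁ * ε ^ 2 + ε * (C₂ * ε))) := by
        gcongr
        refine (abs_add_le _ _).trans (add_le_add h0 ?_)
        rw [abs_mul, abs_of_nonneg hm0]
        gcongr
        refine (abs_add_le _ _).trans (add_le_add h1 ?_)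
        rw [abs_mul, abs_of_pos hε]
        gcongr
    _ = D * (K + m * (C₁ + C₂)) * ε ^ 2 := by ring
    _ ≤ (|D * (K + m * (C₁ + C₂))| + 1) * ε ^ 2 := by
        gcongr
        linarith [le_abs_self (D * (K + m * (C₁ + C₂)))]
end

section
/- Let d ≥ 1, fix x ∈ ℝ^d, a symmetric positive-definite d×d real matrix A, and b ∈ ℝ^d, and let f : ℝ^d → ℝ be four times continuously differentiable with f and all its partial derivatives up to order 4 bounded. Then lim_{ε→0⁺} (1/ε) · ( ( ∫_{ℝ^d} K(ε,x,y) f(y) dy ) / ( ∫_{ℝ^d} K(ε,x,y) dy ) − f(x) ) = ∑_i b_i ∂_i f(x) + ½ ∑_{i,j} A_{ij} ∂_i ∂_j f(x), where K(ε,x,y) = exp(−(y−x−εb)ᵀA⁻¹(y−x−εb)/(2ε)). (Euclidean case of the theorem that the left-normalized local-kernel operator L_ε f = ((G_ε 1)^{-1} G_ε f − f)/ε converges to (1/m)·𝓛f, the generator of the Markov process with drift b and diffusion matrix √A.) -/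
open MeasureTheory Matrix

open ProbabilityTheory

/-- The standard Gaussian measure on `Fin d → ℝ`. -/
noncomputable def stdGaussianPi (d : ℕ) : Measure (Fin d → ℝ) :=
  Measure.pi fun _ => gaussianReal 0 1

instance (d : ℕ) : IsProbabilityMeasure (stdGaussianPi d) := by
  unfold stdGaussianPi; infer_instance

lemma stdGaussianPi_eq_withDensity (d : ℕ) :
    stdGaussianPi d = (volume : Measure (Fin d → ℝ)).withDensity
      fun z => ENNReal.ofReal (∏ k, gaussianPDFReal 0 1 (z k)) := by
  refine Measure.pi_eq fun s hs => ?_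
  have hW : Integrable (fun z : Fin d → ℝ => ∏ k, gaussianPDFReal 0 1 (z k)) :=
    Integrable.fintype_prod (f := fun _ : Fin d => gaussianPDFReal 0 1)
      fun _ => integrable_gaussianPDFReal 0 1
  rw [withDensity_apply _ (MeasurableSet.univ_pi hs),
    ← ofReal_integral_eq_lintegral_ofReal hW.integrableOn
      (Filter.Eventually.of_forall fun z => Finset.prod_nonneg fun k _ =>
        gaussianPDFReal_nonneg 0 1 (z k)),
    volume_pi, Measure.restrict_pi_pi,
    integral_fintype_prod_eq_prod (fun _ : Fin d => gaussianPDFReal 0 1),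
    ENNReal.ofReal_prod_of_nonneg fun k _ => integral_nonneg fun t => gaussianPDFReal_nonneg 0 1 t]
  exact Finset.prod_congr rfl fun k _ => (gaussianReal_apply_eq_integral 0 one_ne_zero _).symm

lemma integral_stdGaussianPi (d : ℕ) (F : (Fin d → ℝ) → ℝ) :
    ∫ z, F z ∂stdGaussianPi d =
      (√(2 * Real.pi))⁻¹ ^ d * ∫ z : Fin d → ℝ, Real.exp (-(z ⬝ᵥ z) / 2) * F z := by
  rw [stdGaussianPi_eq_withDensity, integral_withDensity_eq_integral_toReal_smul
    (by fun_prop) (Filter.Eventually.of_forall fun _ => ENNReal.ofReal_lt_top),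
    ← integral_const_mul]
  refine integral_congr_ae (Filter.Eventually.of_forall fun z => ?_)
  have hW : ∏ k, gaussianPDFReal 0 1 (z k) =
      (√(2 * Real.pi))⁻¹ ^ d * Real.exp (-(z ⬝ᵥ z) / 2) := by
    simp only [gaussianPDFReal, Finset.prod_mul_distrib, ← Real.exp_sum, dotProduct]
    congr 1
    · simp
    · rw [← Finset.sum_neg_distrib, Finset.sum_div]
      simp [pow_two]
  simp only [smul_eq_mul]
  rw [ENNReal.toReal_ofReal (Finset.prod_nonneg fun k _ => gaussianPDFReal_nonneg 0 1 (z k)), hW,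
    mul_assoc]

lemma memLp_eval_stdGaussianPi {d : ℕ} (i : Fin d) :
    MemLp (fun z : Fin d → ℝ => z i) 2 (stdGaussianPi d) :=
  (memLp_id_gaussianReal (μ := 0) (v := 1) 2).comp_measurePreserving
    (measurePreserving_eval (fun _ : Fin d => gaussianReal 0 1) i)

lemma integral_eval_stdGaussianPi {d : ℕ} (i : Fin d) :
    ∫ z, z i ∂stdGaussianPi d = 0 := by
  unfold stdGaussianPi
  rw [integral_eval (μ := fun _ : Fin d => gaussianReal 0 1), integral_id_gaussianReal]

lemma integral_eval_mul_eval_stdGaussianPi {d : ℕ} (i j : Fin d) :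
    ∫ z, z i * z j ∂stdGaussianPi d = (1 : Matrix (Fin d) (Fin d) ℝ) i j := by
  have h := covariance_eq_sub (memLp_eval_stdGaussianPi i) (memLp_eval_stdGaussianPi j)
  simp only [integral_eval_stdGaussianPi, mul_zero, sub_zero] at h
  refine h.symm.trans ?_
  by_cases hij : i = j
  · subst hij
    have h := variance_id_gaussianReal (μ := 0) (v := 1)
    rw [← (measurePreserving_eval (fun _ : Fin d => gaussianReal 0 1) i).map_eq,
      variance_map aemeasurable_id (measurable_pi_apply i).aemeasurable] at h
    rw [covariance_self (measurable_pi_apply i).aemeasurable, one_apply_eq]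
    exact h.trans NNReal.coe_one
  · rw [one_apply_ne hij]
    exact ((iIndepFun_pi (X := fun (_ : Fin d) (t : ℝ) => t) (μ := fun _ : Fin d => gaussianReal 0 1)
      fun _ => by fun_prop).indepFun hij).covariance_eq_zero
      (memLp_eval_stdGaussianPi i) (memLp_eval_stdGaussianPi j)

/-- Second moments of the image of the standard Gaussian under a matrix `S`, contracted with
a bilinear form. -/
lemma integral_bilin_stdGaussianPi {d : ℕ} (S : Matrix (Fin d) (Fin d) ℝ)
    (H : (Fin d → ℝ) →L[ℝ] (Fin d → ℝ) →L[ℝ] ℝ) :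
    ∫ z, H (S *ᵥ z) (S *ᵥ z) ∂stdGaussianPi d =
      ∑ i, ∑ j, (S * Sᵀ) i j * H (Pi.single i 1) (Pi.single j 1) := by
  have hint (k l : Fin d) : Integrable (fun z : Fin d → ℝ => z k * z l) (stdGaussianPi d) :=
    (memLp_eval_stdGaussianPi k).integrable_mul (memLp_eval_stdGaussianPi l)
  have hexp (v : Fin d → ℝ) :
      H v v = ∑ i, ∑ j, v i * v j * H (Pi.single i 1) (Pi.single j 1) := by
    conv_lhs => rw [pi_eq_sum_univ' v]
    simp only [map_sum, _root_.sum_apply, map_smul, _root_.smul_apply, smul_eq_mul,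
      Finset.mul_sum, mul_assoc]
    rw [Finset.sum_comm]
    exact Finset.sum_congr rfl fun i _ => Finset.sum_congr rfl fun j _ => by ring
  have hprod (i j : Fin d) (z : Fin d → ℝ) :
      (S *ᵥ z) i * (S *ᵥ z) j = ∑ k, ∑ l, S i k * S j l * (z k * z l) := by
    simp only [mulVec, dotProduct, Finset.sum_mul_sum]
    exact Finset.sum_congr rfl fun k _ => Finset.sum_congr rfl fun l _ => by ring
  have hint' (i j : Fin d) :
      Integrable (fun z : Fin d → ℝ => (S *ᵥ z) i * (S *ᵥ z) j) (stdGaussianPi d) := by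
    simp only [hprod]
    exact integrable_finsetSum _ fun k _ => integrable_finsetSum _ fun l _ =>
      (hint k l).const_mul _
  simp only [hexp]
  rw [integral_finsetSum _ fun i _ => integrable_finsetSum _ fun j _ =>
    (hint' i j).mul_const _]
  refine Finset.sum_congr rfl fun i _ => ?_
  rw [integral_finsetSum _ fun j _ => (hint' i j).mul_const _]
  refine Finset.sum_congr rfl fun j _ => ?_
  rw [integral_mul_const]
  congr 1
  simp only [hprod]
  rw [integral_finsetSum _ fun k _ => integrable_finsetSum _ fun l _ => (hint k l).const_mul _]
  simp only [integral_finsetSum _ fun l _ => (hint _ l).const_mul _, integral_const_mul,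
    integral_eval_mul_eval_stdGaussianPi]
  simp [mul_apply, one_apply]

lemma integral_kernel_mul {d : ℕ} (x b : Fin d → ℝ) (A S : Matrix (Fin d) (Fin d) ℝ)
    (hS : S * Sᵀ = A) (hdet : S.det ≠ 0) (ε : ℝ) (hε : 0 < ε) :
    ∃ C : ℝ, C ≠ 0 ∧ ∀ F : (Fin d → ℝ) → ℝ,
      ∫ y : Fin d → ℝ,
        Real.exp (-((y - x - ε • b) ⬝ᵥ (A⁻¹ *ᵥ (y - x - ε • b))) / (2 * ε)) * F y =
      C * ∫ z, F (x + ε • b + √ε • (S *ᵥ z)) ∂stdGaussianPi d := by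
  have hs : √ε ≠ 0 := (Real.sqrt_pos.2 hε).ne'
  set M := √ε • S with hM
  have hMdet : M.det ≠ 0 := by
    rw [hM, det_smul]; exact mul_ne_zero (pow_ne_zero _ hs) hdet
  have hp : (√(2 * Real.pi))⁻¹ ^ d ≠ 0 := by positivity
  refine ⟨|M.det| * ((√(2 * Real.pi))⁻¹ ^ d)⁻¹, by positivity, fun F => ?_⟩
  have hquad (z : Fin d → ℝ) :
      -((M *ᵥ z) ⬝ᵥ (A⁻¹ *ᵥ (M *ᵥ z))) / (2 * ε) = -(z ⬝ᵥ z) / 2 := by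
    have h : (S *ᵥ z) ⬝ᵥ (A⁻¹ *ᵥ (S *ᵥ z)) = z ⬝ᵥ z := by
      rw [← hS, Matrix.mul_inv_rev, ← mulVec_mulVec, mulVec_mulVec (M := S⁻¹),
        nonsing_inv_mul _ hdet.isUnit, one_mulVec, ← transpose_nonsing_inv,
        dotProduct_transpose_mulVec, mulVec_mulVec, nonsing_inv_mul _ hdet.isUnit, one_mulVec]
    rw [hM, smul_mulVec, mulVec_smul, smul_dotProduct, dotProduct_smul, h, smul_smul,
      Real.mul_self_sqrt hε.le, smul_eq_mul]
    field_simp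
  have hcov (G : (Fin d → ℝ) → ℝ) : ∫ y, G y = |M.det| * ∫ z, G (M *ᵥ z) := by
    have h := Real.map_matrix_volume_pi_eq_smul_volume_pi hMdet
    have hemb : MeasurableEmbedding (toLin' M) :=
      (LinearMap.equivOfDetNeZero (toLin' M)
        (by rwa [LinearMap.det_toLin'])).toContinuousLinearEquiv.toHomeomorph.measurableEmbedding
    have h2 := hemb.integral_map (μ := volume) G
    rw [h, integral_smul_measure, ENNReal.toReal_ofReal (abs_nonneg _)] at h2
    simp only [toLin'_apply, smul_eq_mul, abs_inv] at h2
    rw [← h2, mul_inv_cancel_left₀ (abs_ne_zero.2 hMdet)]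
  rw [integral_stdGaussianPi, mul_assoc, inv_mul_cancel_left₀ hp,
    ← integral_add_right_eq_self _ (x + ε • b), hcov]
  congr 1
  refine integral_congr_ae (Filter.Eventually.of_forall fun z => ?_)
  have h1 : M *ᵥ z + (x + ε • b) - x - ε • b = M *ᵥ z := by abel
  simp only [h1, hquad]
  rw [hM, smul_mulVec, add_comm (√ε • _)]

/-- Second-order expansion, with Lagrange remainder, along a parabolic curve. -/
lemma exists_taylor_along_parabola {E : Type*} [NormedAddCommGroup E] [NormedSpace ℝ E]
    {f : E → ℝ} (hf : ContDiff ℝ 2 f) (x b v : E) {s : ℝ} (hs : 0 < s) :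
    ∃ t ∈ Set.Ioo 0 s, (f (x + s ^ 2 • b + s • v) - f x - s * fderiv ℝ f x v) / s ^ 2 =
      (1 / 2) * (fderiv ℝ (fderiv ℝ f) (x + t ^ 2 • b + t • v) ((2 * t) • b + v)
        ((2 * t) • b + v) + fderiv ℝ f (x + t ^ 2 • b + t • v) ((2 : ℝ) • b)) := by
  set p : ℝ → E := fun t => x + t ^ 2 • b + t • v with hp
  have hpd (t : ℝ) : HasDerivAt p ((2 * t) • b + v) t := by
    have h1 := ((hasDerivAt_pow 2 t).smul_const b).const_add x
    have h2 := (hasDerivAt_id t).smul_const v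
    exact HasDerivAt.congr_deriv (f := p) (h1.add h2) (by simp)
  have hpd2 (t : ℝ) : HasDerivAt (fun t : ℝ => (2 * t) • b + v) ((2 : ℝ) • b) t := by
    simpa using (((hasDerivAt_id t).const_mul 2).smul_const b).add_const v
  have hg1 (t : ℝ) : HasDerivAt (fun t => f (p t)) (fderiv ℝ f (p t) ((2 * t) • b + v)) t :=
    ((hf.differentiable (by norm_num)) (p t)).hasFDerivAt.comp_hasDerivAt t (hpd t)
  have hf' : Differentiable ℝ (fderiv ℝ f) :=
    (hf.fderiv_right (m := 1) (by norm_num)).differentiable (by norm_num)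
  have hg2 (t : ℝ) : HasDerivAt (fun t => fderiv ℝ f (p t) ((2 * t) • b + v))
      (fderiv ℝ (fderiv ℝ f) (p t) ((2 * t) • b + v) ((2 * t) • b + v) +
        fderiv ℝ f (p t) ((2 : ℝ) • b)) t :=
    ((hf' (p t)).hasFDerivAt.comp_hasDerivAt t (hpd t)).clm_apply (hpd2 t)
  have hgc : ContDiff ℝ 2 (fun t => f (p t)) := hf.comp (by fun_prop)
  obtain ⟨t, ht, h⟩ := taylor_mean_remainder_lagrange_iteratedDeriv (n := 1) hs.ne
    (f := fun t => f (p t)) (by exact_mod_cast hgc.contDiffOn)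
  rw [Set.uIoo_of_lt hs] at ht
  refine ⟨t, ht, ?_⟩
  have hd1 : deriv (fun t => f (p t)) = fun t => fderiv ℝ f (p t) ((2 * t) • b + v) :=
    funext fun t => (hg1 t).deriv
  rw [iteratedDeriv_succ, iteratedDeriv_one, hd1, (hg2 t).deriv, taylorWithinEval_succ,
    taylor_within_zero_eval, iteratedDerivWithin_one,
    (hg1 0).hasDerivWithinAt.derivWithin
      (uniqueDiffOn_uIcc hs.ne 0 Set.left_mem_uIcc)] at h
  rw [div_eq_iff (by positivity)]
  simp [hp] at h ⊢
  linarith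

lemma norm_fderiv_fderiv_eq {E F : Type*} [NormedAddCommGroup E] [NormedSpace ℝ E]
    [NormedAddCommGroup F] [NormedSpace ℝ F] (f : E → F) (y : E) :
    ‖fderiv ℝ (fderiv ℝ f) y‖ = ‖iteratedFDeriv ℝ 2 f y‖ := by
  rw [← norm_iteratedFDeriv_one, norm_iteratedFDeriv_fderiv]

lemma pd_pd_eq {d : ℕ} {f : (Fin d → ℝ) → ℝ} (hf : ContDiff ℝ 2 f) (x : Fin d → ℝ)
    (i j : Fin d) :
    pd i (pd j f) x = fderiv ℝ (fderiv ℝ f) x (Pi.single i 1) (Pi.single j 1) := by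
  have hf' : DifferentiableAt ℝ (fderiv ℝ f) x :=
    (hf.fderiv_right (m := 1) (by norm_num)).differentiable (by norm_num) x
  unfold pd
  rw [fderiv_clm_apply hf' (differentiableAt_const _)]
  simp

lemma exists_sqrt_of_posDef {d : ℕ} {A : Matrix (Fin d) (Fin d) ℝ} (hA : A.PosDef) :
    ∃ S : Matrix (Fin d) (Fin d) ℝ, S * Sᵀ = A ∧ S.det ≠ 0 := by
  open scoped MatrixOrder in
  have hSA : CFC.sqrt A * CFC.sqrt A = A := CFC.sqrt_mul_sqrt_self A hA.posSemidef.nonneg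
  open scoped MatrixOrder in
  have hsym : (CFC.sqrt A)ᵀ = CFC.sqrt A := (CFC.sqrt_nonneg A).isSelfAdjoint
  refine ⟨CFC.sqrt A, by rw [hsym, hSA], fun h => hA.det_pos.ne' ?_⟩
  rw [← hSA, det_mul, h, mul_zero]

lemma norm_taylor_along_parabola_le {E : Type*} [NormedAddCommGroup E] [NormedSpace ℝ E]
    {f : E → ℝ} (hf : ContDiff ℝ 2 f) {M₁ M₂ : ℝ} (h₁ : ∀ y, ‖fderiv ℝ f y‖ ≤ M₁)
    (h₂ : ∀ y, ‖fderiv ℝ (fderiv ℝ f) y‖ ≤ M₂) (x b v : E) {s : ℝ} (hs : 0 < s) (hs1 : s ≤ 1) :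
    ‖(f (x + s ^ 2 • b + s • v) - f x - s * fderiv ℝ f x v) / s ^ 2‖ ≤
      (1 / 2) * (M₂ * (2 * ‖b‖ + ‖v‖) ^ 2 + M₁ * (2 * ‖b‖)) := by
  obtain ⟨t, ht, h⟩ := exists_taylor_along_parabola hf x b v hs
  set y := x + t ^ 2 • b + t • v
  set w := (2 * t) • b + v with hw
  have hM₁ : 0 ≤ M₁ := (norm_nonneg _).trans (h₁ x)
  have hM₂ : 0 ≤ M₂ := (norm_nonneg (fderiv ℝ (fderiv ℝ f) x)).trans (h₂ x)
  have hwn : ‖w‖ ≤ 2 * ‖b‖ + ‖v‖ := by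
    refine (norm_add_le _ _).trans (add_le_add_left ?_ _)
    rw [norm_smul, Real.norm_of_nonneg (by linarith [ht.1])]
    exact mul_le_mul_of_nonneg_right (by linarith [ht.2]) (norm_nonneg b)
  have hb : ‖(2 : ℝ) • b‖ = 2 * ‖b‖ := by rw [norm_smul, Real.norm_ofNat]
  have e₂ : ‖fderiv ℝ (fderiv ℝ f) y w w‖ ≤ M₂ * (2 * ‖b‖ + ‖v‖) ^ 2 := by
    refine (ContinuousLinearMap.le_opNorm₂ _ _ _).trans ?_
    rw [mul_assoc, ← pow_two]
    exact mul_le_mul (h₂ y) (pow_le_pow_left₀ (norm_nonneg w) hwn 2) (by positivity) hM₂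
  have e₁ : ‖fderiv ℝ f y ((2 : ℝ) • b)‖ ≤ M₁ * (2 * ‖b‖) := by
    rw [← hb]
    exact ContinuousLinearMap.le_of_opNorm_le _ (h₁ y) _
  rw [h, norm_mul, Real.norm_of_nonneg (by norm_num : (0 : ℝ) ≤ 1 / 2)]
  gcongr
  exact norm_add_le_of_le e₂ e₁

lemma tendsto_taylor_along_parabola {E : Type*} [NormedAddCommGroup E] [NormedSpace ℝ E]
    {f : E → ℝ} (hf : ContDiff ℝ 2 f) (x b v : E) :
    Filter.Tendsto
      (fun s : ℝ => (f (x + s ^ 2 • b + s • v) - f x - s * fderiv ℝ f x v) / s ^ 2)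
      (nhdsWithin 0 (Set.Ioi 0))
      (nhds (fderiv ℝ f x b + (1 / 2) * fderiv ℝ (fderiv ℝ f) x v v)) := by
  set G : ℝ → ℝ := fun t => (1 / 2) * (fderiv ℝ (fderiv ℝ f) (x + t ^ 2 • b + t • v)
    ((2 * t) • b + v) ((2 * t) • b + v) + fderiv ℝ f (x + t ^ 2 • b + t • v) ((2 : ℝ) • b)) with hG
  have hf' : ContDiff ℝ 1 (fderiv ℝ f) := hf.fderiv_right (by norm_num)
  have c₁ : Continuous (fderiv ℝ f) := hf'.continuous
  have c₂ : Continuous (fderiv ℝ (fderiv ℝ f)) := hf'.continuous_fderiv (by norm_num)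
  have hGc : Continuous G := by fun_prop
  have hG0 : G 0 = fderiv ℝ f x b + (1 / 2) * fderiv ℝ (fderiv ℝ f) x v v := by
    simp [hG]; ring
  choose! t ht h using fun s (hs : 0 < s) => exists_taylor_along_parabola hf x b v hs
  have htt : Filter.Tendsto t (nhdsWithin 0 (Set.Ioi 0)) (nhds 0) :=
    tendsto_of_tendsto_of_tendsto_of_le_of_le' tendsto_const_nhds
      (Filter.tendsto_id.mono_left nhdsWithin_le_nhds)
      (by filter_upwards [self_mem_nhdsWithin] with s hs using (ht s hs).1.le)
      (by filter_upwards [self_mem_nhdsWithin] with s hs using (ht s hs).2.le)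
  rw [← hG0]
  refine ((hGc.tendsto 0).comp htt).congr' ?_
  filter_upwards [self_mem_nhdsWithin] with s hs using (h s hs).symm

/-- Euclidean case of the convergence of the left-normalized local-kernel operator:
`L_ε f = ((G_ε 1)⁻¹ G_ε f − f)/ε` converges to the generator
`𝓛f = ∑ bᵢ ∂ᵢ f + ½ ∑ Aᵢⱼ ∂ᵢ∂ⱼ f` as `ε → 0⁺`. -/
theorem left_normalized_kernel_converges_to_generator
    (d : ℕ) (hd : 1 ≤ d) (x : Fin d → ℝ)
    (A : Matrix (Fin d) (Fin d) ℝ) (hA : A.PosDef) (b : Fin d → ℝ)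
    (f : (Fin d → ℝ) → ℝ) (hf : ContDiff ℝ 4 f)
    (hbdd : ∀ k : ℕ, k ≤ 4 → ∃ M : ℝ, ∀ y, ‖iteratedFDeriv ℝ k f y‖ ≤ M) :
    Filter.Tendsto
      (fun ε : ℝ =>
        (1 / ε) *
          ((∫ y : Fin d → ℝ,
              Real.exp (-((y - x - ε • b) ⬝ᵥ (A⁻¹ *ᵥ (y - x - ε • b))) / (2 * ε)) * f y) /
            (∫ y : Fin d → ℝ,
              Real.exp (-((y - x - ε • b) ⬝ᵥ (A⁻¹ *ᵥ (y - x - ε • b))) / (2 * ε)))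
          - f x))
      (nhdsWithin 0 (Set.Ioi 0))
      (nhds ((∑ i, b i * pd i f x) + (1 / 2) * ∑ i, ∑ j, A i j * pd i (pd j f) x)) := by
  have hf2 : ContDiff ℝ 2 f := hf.of_le (by norm_num)
  obtain ⟨M₀, hM₀⟩ := hbdd 0 (by norm_num)
  obtain ⟨M₁, hM₁⟩ := hbdd 1 (by norm_num)
  obtain ⟨M₂, hM₂⟩ := hbdd 2 (by norm_num)
  simp only [norm_iteratedFDeriv_zero, norm_iteratedFDeriv_one, ← norm_fderiv_fderiv_eq]
    at hM₀ hM₁ hM₂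
  obtain ⟨S, hS, hdet⟩ := exists_sqrt_of_posDef hA
  have hid : MemLp (fun z : Fin d → ℝ => z) 2 (stdGaussianPi d) :=
    MemLp.of_eval memLp_eval_stdGaussianPi
  have hSc : Continuous fun z : Fin d → ℝ => S *ᵥ z := by fun_prop
  have hSz : MemLp (fun z : Fin d → ℝ => S *ᵥ z) 2 (stdGaussianPi d) :=
    (LinearMap.toContinuousLinearMap (toLin' S)).comp_memLp' hid
  have hSint : Integrable (fun z : Fin d → ℝ => S *ᵥ z) (stdGaussianPi d) :=
    hSz.integrable (by norm_num)
  have hSmean (L : (Fin d → ℝ) →L[ℝ] ℝ) : ∫ z, L (S *ᵥ z) ∂stdGaussianPi d = 0 := by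
    have hz : ∫ z, z ∂stdGaussianPi d = (0 : Fin d → ℝ) := by
      ext i
      rw [eval_integral fun i => (memLp_eval_stdGaussianPi i).integrable (by norm_num)]
      exact integral_eval_stdGaussianPi i
    have := (L.comp (LinearMap.toContinuousLinearMap (toLin' S))).integral_comp_comm
      (hid.integrable (by norm_num))
    simpa [hz] using this
  have hquad : Integrable (fun z => fderiv ℝ (fderiv ℝ f) x (S *ᵥ z) (S *ᵥ z))
      (stdGaussianPi d) := by
    refine (hSz.norm.integrable_sq.const_mul ‖fderiv ℝ (fderiv ℝ f) x‖).mono'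
      (by fun_prop) (Filter.Eventually.of_forall fun z => ?_)
    simpa [pow_two, mul_assoc] using (fderiv ℝ (fderiv ℝ f) x).le_opNorm₂ (S *ᵥ z) (S *ᵥ z)
  have hlim : (∑ i, b i * pd i f x) + (1 / 2) * ∑ i, ∑ j, A i j * pd i (pd j f) x =
      ∫ z, (fderiv ℝ f x b + (1 / 2) * fderiv ℝ (fderiv ℝ f) x (S *ᵥ z) (S *ᵥ z))
        ∂stdGaussianPi d := by
    rw [integral_add (integrable_const _) (hquad.const_mul _), integral_const_mul,
      integral_bilin_stdGaussianPi, hS]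
    simp only [pd_pd_eq hf2]
    congr 1
    conv_rhs => rw [pi_eq_sum_univ' b]
    simp [pd]
  have hdct : Filter.Tendsto
      (fun s : ℝ => ∫ z, (f (x + s ^ 2 • b + s • (S *ᵥ z)) - f x - s * fderiv ℝ f x (S *ᵥ z)) /
        s ^ 2 ∂stdGaussianPi d) (nhdsWithin 0 (Set.Ioi 0))
      (nhds ((∑ i, b i * pd i f x) + (1 / 2) * ∑ i, ∑ j, A i j * pd i (pd j f) x)) := by
    rw [hlim]
    refine tendsto_integral_filter_of_dominated_convergence
      (fun z => (1 / 2) * (M₂ * (2 * ‖b‖ + ‖S *ᵥ z‖) ^ 2 + M₁ * (2 * ‖b‖))) ?_ ?_ ?_ ?_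
    · have hfc := hf.continuous
      exact Filter.Eventually.of_forall fun s => Continuous.aestronglyMeasurable (by fun_prop)
    · filter_upwards [Ioc_mem_nhdsGT (zero_lt_one' ℝ)] with s hs
      exact Filter.Eventually.of_forall fun z =>
        norm_taylor_along_parabola_le hf2 hM₁ hM₂ x b (S *ᵥ z) hs.1 hs.2
    · have h := ((memLp_const (2 * ‖b‖)).add hSz.norm).integrable_sq
      exact ((h.const_mul M₂).add (integrable_const _)).const_mul _
    · exact Filter.Eventually.of_forall fun z => tendsto_taylor_along_parabola hf2 x b (S *ᵥ z)
  have hsqrt : Filter.Tendsto Real.sqrt (nhdsWithin 0 (Set.Ioi 0)) (nhdsWithin 0 (Set.Ioi 0)) := by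
    refine tendsto_nhdsWithin_iff.2 ⟨?_, ?_⟩
    · simpa using (Real.continuous_sqrt.tendsto 0).mono_left nhdsWithin_le_nhds
    · filter_upwards [self_mem_nhdsWithin] with ε hε using Real.sqrt_pos.2 hε
  refine (hdct.comp hsqrt).congr' ?_
  filter_upwards [self_mem_nhdsWithin] with ε (hε : 0 < ε)
  obtain ⟨C, hC, hK⟩ := integral_kernel_mul x b A S hS hdet ε hε
  have hden := hK fun _ => 1
  simp only [mul_one, integral_const, probReal_univ, smul_eq_mul] at hden
  have hfi : Integrable (fun z => f (x + ε • b + √ε • (S *ᵥ z))) (stdGaussianPi d) := by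
    have hfc := hf.continuous
    exact .of_bound (Continuous.aestronglyMeasurable (by fun_prop)) M₀
      (Filter.Eventually.of_forall fun z => hM₀ _)
  rw [hK f, hden, mul_div_cancel_left₀ _ hC]
  simp only [Function.comp_apply, Real.sq_sqrt hε.le]
  rw [integral_div, integral_sub (f := fun z => f (x + ε • b + √ε • (S *ᵥ z)) - f x)
    (hfi.sub (integrable_const _))
    (((fderiv ℝ f x).integrable_comp hSint).const_mul _), integral_sub hfi (integrable_const _),
    integral_const_mul, hSmean]
  simp
  ring
end

section
/- Let d ≥ 1, let A : ℝ^d → (symmetric positive-definite d×d real matrices) and b : ℝ^d → ℝ^d be smooth, with constants 0 < λ ≤ Λ such that λ‖v‖² ≤ vᵀA(y)v ≤ Λ‖v‖² for all y, v, with b bounded, and with all partial derivatives of the entries of A and b bounded. Let f : ℝ^d → ℝ be smooth with compact support, and set m(y) = (2π)^{d/2}(det A(y))^{1/2}. Then for every x ∈ ℝ^d, lim_{ε→0⁺} (1/ε)·( ε^{−d/2} ∫_{ℝ^d} exp(−(x−y−εb(y))ᵀA(y)⁻¹(x−y−εb(y))/(2ε)) f(y) dy − m(x) f(x) ) = −∑_i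 ∂_i( m·b_i·f )(x) + ½ ∑_{i,j} ∂_i ∂_j ( m·A_{ij}·f )(x). (Euclidean case of the expansion of the adjoint of a skew-free local kernel: the adjoint operator G*_ε recovers the Fokker–Planck operator 𝓛* with drift μ = m·b and diffusion coefficient C = m·A.) -/
open MeasureTheory Matrix

section Auxiliary

open scoped SchwartzMap LineDeriv ContDiff

section Coercive

variable {W : Type*} [NormedAddCommGroup W] [NormedSpace ℝ W]

lemma one_add_pow_mul_exp_neg_sq_le {c : ℝ} (hc : 0 < c) (K : ℕ) :
    ∃ C : ℝ, ∀ r : ℝ, 0 ≤ r → (1 + r) ^ K * Real.exp (-(c * r ^ 2)) ≤ C := by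
  refine ⟨K.factorial * Real.exp (1 + 1 / (4 * c)), fun r hr => ?_⟩
  have h1 : (1 + r) ^ K ≤ K.factorial * Real.exp (1 + r) := by
    have := Real.pow_div_factorial_le_exp (1 + r) (by positivity) K
    rwa [div_le_iff₀' (by positivity)] at this
  have h2 : 1 + r - c * r ^ 2 ≤ 1 + 1 / (4 * c) := by
    have h3 : 1 / (4 * c) - r + c * r ^ 2 = (2 * c * r - 1) ^ 2 / (4 * c) := by
      field_simp
      ring
    have h4 : 0 ≤ (2 * c * r - 1) ^ 2 / (4 * c) := by positivity
    linarith
  calc (1 + r) ^ K * Real.exp (-(c * r ^ 2))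
      ≤ K.factorial * Real.exp (1 + r) * Real.exp (-(c * r ^ 2)) := by gcongr
    _ = K.factorial * Real.exp (1 + r - c * r ^ 2) := by
      rw [mul_assoc, ← Real.exp_add, sub_eq_add_neg]
    _ ≤ _ := by gcongr

/-- If `q` has temperate growth and is bounded below by a multiple of `‖w‖ ^ 2`, then `exp (-q)` is
a Schwartz function. -/
lemma exists_schwartzMap_exp_neg {q : W → ℝ} (hq : q.HasTemperateGrowth) {c : ℝ} (hc : 0 < c)
    (hle : ∀ w, c * ‖w‖ ^ 2 ≤ q w) :
    ∃ S : 𝓢(W, ℝ), ∀ w, S w = Real.exp (-q w) := by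
  have hsm : ContDiff ℝ ∞ (fun w => Real.exp (-q w)) := hq.1.neg.exp
  refine ⟨⟨fun w => Real.exp (-q w), hsm, fun k n => ?_⟩, fun w => rfl⟩
  obtain ⟨N, C, hC0, hC⟩ := hq.norm_iteratedFDeriv_le_uniform n
  obtain ⟨C', hC'⟩ := one_add_pow_mul_exp_neg_sq_le hc (k + N * n)
  refine ⟨n.factorial * (1 + C) ^ n * C', fun w => ?_⟩
  set D : ℝ := (1 + C) * (1 + ‖w‖) ^ N with hD
  have hw1 : (1 : ℝ) ≤ (1 + ‖w‖) ^ N := one_le_pow₀ (by linarith [norm_nonneg w])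
  have hD1 : 1 ≤ D := by
    rw [hD]; nlinarith
  have hexp : ContDiff ℝ ∞ (fun t : ℝ => Real.exp (-t)) := contDiff_neg.exp
  have key := norm_iteratedFDeriv_comp_le (g := fun t : ℝ => Real.exp (-t)) (f := q) (n := n)
    (N := ∞) hexp hq.1 (by exact_mod_cast le_top) w (C := Real.exp (-q w)) (D := D)
    (fun i _ => by
      rw [norm_iteratedFDeriv_eq_norm_iteratedDeriv]
      rw [iteratedDeriv_comp_neg, iteratedDeriv_eq_iterate, Real.iter_deriv_exp, norm_smul]
      simp)
    (fun i hi hin => by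
      calc ‖iteratedFDeriv ℝ i q w‖ ≤ C * (1 + ‖w‖) ^ N := hC i hin w
        _ ≤ D := by rw [hD]; gcongr; linarith
        _ ≤ D ^ i := le_self_pow₀ hD1 (by omega))
  calc ‖w‖ ^ k * ‖iteratedFDeriv ℝ n (fun w => Real.exp (-q w)) w‖
      ≤ (1 + ‖w‖) ^ k * (n.factorial * Real.exp (-(c * ‖w‖ ^ 2)) * D ^ n) := by
        refine mul_le_mul (by gcongr; linarith) (key.trans ?_) (norm_nonneg _) (by positivity)
        have := hle w
        gcongr
    _ = n.factorial * (1 + C) ^ n *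
          ((1 + ‖w‖) ^ (k + N * n) * Real.exp (-(c * ‖w‖ ^ 2))) := by
        rw [hD, mul_pow, pow_add, pow_mul]; ring
    _ ≤ _ := by
        gcongr
        exact hC' _ (norm_nonneg _)

end Coercive

section Parametric

variable {V W E : Type*} [NormedAddCommGroup V] [NormedSpace ℝ V] [FiniteDimensional ℝ V]
  [MeasurableSpace V] [BorelSpace V]
  [NormedAddCommGroup W] [NormedSpace ℝ W]
  [NormedAddCommGroup E] [NormedSpace ℝ E]

lemma SchwartzMap.exists_pow_mul_norm_le {F : Type*} [NormedAddCommGroup F] [NormedSpace ℝ F]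
    (G : 𝓢(W, F)) (k l : ℕ) :
    ∃ C : ℝ, ∀ (w : W) (r : ℝ), 0 ≤ r → r ≤ ‖w‖ → r ^ k * ‖G w‖ ≤ C * (1 + r) ^ (-(l : ℝ)) := by
  refine ⟨2 ^ l * (SchwartzMap.seminorm ℝ 0 0 G + SchwartzMap.seminorm ℝ (k + l) 0 G),
    fun w r hr hrw => ?_⟩
  refine pow_mul_le_of_le_of_pow_mul_le hr (norm_nonneg _) (G.norm_le_seminorm ℝ w) ?_
  refine le_trans ?_ (G.norm_pow_mul_le_seminorm ℝ (k + l) w)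
  gcongr

lemma SchwartzMap.integrable_comp_of_norm_le {F : Type*} [NormedAddCommGroup F] [NormedSpace ℝ F]
    (μ : Measure V) [μ.IsAddHaarMeasure] (G : 𝓢(W, F)) {u : V → W} (hu : Continuous u)
    (hle : ∀ z, ‖z‖ ≤ ‖u z‖) : Integrable (fun z => G (u z)) μ := by
  obtain ⟨C, hC⟩ := G.exists_pow_mul_norm_le 0 μ.integrablePower
  refine ((μ.integrable_pow_neg_integrablePower).const_mul C).mono'
    (G.continuous.comp hu).aestronglyMeasurable (.of_forall fun z => ?_)
  simpa using hC (u z) ‖z‖ (norm_nonneg _) (hle z)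

/-- Differentiation under the integral sign for a Schwartz function evaluated along a family of
affine maps. -/
lemma SchwartzMap.hasFDerivAt_integral_affine (μ : Measure V) [μ.IsAddHaarMeasure]
    (G : 𝓢(W, ℝ)) {u : V → W} (hu : Continuous u) {L : V → E →L[ℝ] W} (hL : Continuous L)
    (hle : ∀ z p, ‖z‖ ≤ ‖u z + L z p‖) {C : ℝ} (hLC : ∀ z, ‖L z‖ ≤ C * (1 + ‖z‖)) (p : E) :
    Integrable (fun z => (fderiv ℝ G (u z + L z p)).comp (L z)) μ ∧
    HasFDerivAt (fun p => ∫ z, G (u z + L z p) ∂μ)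
      (∫ z, (fderiv ℝ G (u z + L z p)).comp (L z) ∂μ) p := by
  have hcont : ∀ p, Continuous fun z => u z + L z p := fun p => by fun_prop
  set G' := SchwartzMap.fderivCLM ℝ W ℝ G with hG'
  have hG'app : ∀ w, fderiv ℝ G w = G' w := fun w => rfl
  obtain ⟨C₀, hC₀⟩ := G'.exists_pow_mul_norm_le 0 μ.integrablePower
  obtain ⟨C₁, hC₁⟩ := G'.exists_pow_mul_norm_le 1 μ.integrablePower
  have hC : 0 ≤ C := by simpa using (norm_nonneg _).trans (hLC 0)
  have hmeas : ∀ p, AEStronglyMeasurable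
      (fun z => (fderiv ℝ G (u z + L z p)).comp (L z)) μ := fun p => by
    simp only [hG'app]
    exact ((G'.continuous.comp (hcont p)).clm_comp hL).aestronglyMeasurable
  have hbd : ∀ z p, ‖(fderiv ℝ G (u z + L z p)).comp (L z)‖ ≤
      C * (C₀ + C₁) * (1 + ‖z‖) ^ (-(μ.integrablePower : ℝ)) := fun z p => by
    have h0 := hC₀ (u z + L z p) ‖z‖ (norm_nonneg _) (hle z p)
    have h1 := hC₁ (u z + L z p) ‖z‖ (norm_nonneg _) (hle z p)
    rw [hG'app]
    calc ‖(G' (u z + L z p)).comp (L z)‖ ≤ ‖G' (u z + L z p)‖ * ‖L z‖ :=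
          ContinuousLinearMap.opNorm_comp_le _ _
      _ ≤ ‖G' (u z + L z p)‖ * (C * (1 + ‖z‖)) := by gcongr; exact hLC z
      _ = C * (‖z‖ ^ 0 * ‖G' (u z + L z p)‖ + ‖z‖ ^ 1 * ‖G' (u z + L z p)‖) := by ring
      _ ≤ C * (C₀ * (1 + ‖z‖) ^ (-(μ.integrablePower : ℝ)) +
            C₁ * (1 + ‖z‖) ^ (-(μ.integrablePower : ℝ))) := by gcongr
      _ = _ := by ring
  have hbi : Integrable (fun z => C * (C₀ + C₁) * (1 + ‖z‖) ^ (-(μ.integrablePower : ℝ))) μ :=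
    (μ.integrable_pow_neg_integrablePower).const_mul _
  refine ⟨hbi.mono' (hmeas p) (.of_forall fun z => hbd z p), ?_⟩
  refine hasFDerivAt_integral_of_dominated_of_fderiv_le (s := Set.univ)
    (F' := fun p z => (fderiv ℝ G (u z + L z p)).comp (L z)) Filter.univ_mem
    (.of_forall fun p => (G.continuous.comp (hcont p)).aestronglyMeasurable)
    (G.integrable_comp_of_norm_le μ (hcont p) fun z => hle z p) (hmeas p)
    (.of_forall fun z p _ => hbd z p) hbi (.of_forall fun z p _ => ?_)
  exact (G.differentiable _).hasFDerivAt.comp p ((L z).hasFDerivAt.const_add (u z))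

end Parametric

section Second

lemma SchwartzMap.lineDerivOp_comm {W : Type*} [NormedAddCommGroup W] [NormedSpace ℝ W]
    (G : 𝓢(W, ℝ)) (a b : W) : ∂_{a} (∂_{b} G) = ∂_{b} (∂_{a} G) := by
  have key : ∀ a b w, (∂_{a} (∂_{b} G)) w = fderiv ℝ (fderiv ℝ G) w a b := fun a b w => by
    rw [lineDerivOp_apply_eq_fderiv]
    have h : ((∂_{b} G : 𝓢(W, ℝ)) : W → ℝ) = fun w => fderiv ℝ G w b :=
      funext fun w => lineDerivOp_apply_eq_fderiv b G w
    have hd : DifferentiableAt ℝ (fderiv ℝ G) w :=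
      (SchwartzMap.fderivCLM ℝ W ℝ G).differentiableAt
    rw [h, fderiv_clm_apply hd (by fun_prop)]
    simp
  ext w
  rw [key, key]
  exact ((G.contDiffAt 2).isSymmSndFDerivAt (by simp)) a b

/-- L'Hôpital form of the second order Taylor expansion at a critical point. -/
lemma tendsto_sub_div_sq_of_hasDerivAt {φ φ' : ℝ → ℝ} {c : ℝ} (h : ∀ s, HasDerivAt φ (φ' s) s)
    (h0 : φ' 0 = 0) (h' : HasDerivAt φ' c 0) :
    Filter.Tendsto (fun s => (φ s - φ 0) / s ^ 2) (nhdsWithin 0 (Set.Ioi 0)) (nhds (c / 2)) := by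
  have hφ : Continuous φ := continuous_iff_continuousAt.2 fun s => (h s).continuousAt
  refine HasDerivAt.lhopital_zero_nhdsGT (f' := φ') (g' := fun s => 2 * s)
    (.of_forall fun s => (h s).sub_const _)
    (.of_forall fun s => by simpa using hasDerivAt_pow 2 s)
    (by filter_upwards [self_mem_nhdsWithin] with s hs; exact mul_ne_zero two_ne_zero (ne_of_gt hs))
    (tendsto_nhdsWithin_of_tendsto_nhds ?_) (tendsto_nhdsWithin_of_tendsto_nhds ?_) ?_
  · exact (by fun_prop : Continuous fun s => φ s - φ 0).tendsto' _ _ (by simp)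
  · exact (by fun_prop : Continuous fun s : ℝ => s ^ 2).tendsto' _ _ (by simp)
  · have := (h'.tendsto_slope_zero_right).div_const 2
    refine this.congr fun s => ?_
    simp [h0]
    ring

variable {d : ℕ}

local notation "V" => Fin d → ℝ
local notation "W" => ℝ × (Fin d → ℝ) × (Fin d → ℝ)

/-- Multiplication by the `i`-th coordinate of the last variable. -/
noncomputable def coordMul (i : Fin d) : 𝓢(W, ℝ) →L[ℝ] 𝓢(W, ℝ) :=
  SchwartzMap.smulLeftCLM ℝ fun w : W => w.2.2 i

lemma coordMul_apply (i : Fin d) (G : 𝓢(W, ℝ)) (w : W) : coordMul i G w = w.2.2 i * G w := by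
  have h : Function.HasTemperateGrowth fun w : W => w.2.2 i :=
    ((ContinuousLinearMap.proj i).comp ((ContinuousLinearMap.snd ℝ _ _).comp
      (ContinuousLinearMap.snd ℝ ℝ _)) : W →L[ℝ] ℝ).hasTemperateGrowth
  exact SchwartzMap.smulLeftCLM_apply_apply h G w

lemma lineDerivOp_coordMul (i : Fin d) (G : 𝓢(W, ℝ)) (s : ℝ) (y : V) :
    ∂_{((s, y, 0) : W)} (coordMul i G) = coordMul i (∂_{((s, y, 0) : W)} G) := by
  ext w
  rw [coordMul_apply, SchwartzMap.lineDerivOp_apply_eq_fderiv,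
    SchwartzMap.lineDerivOp_apply_eq_fderiv]
  have h : (⇑(coordMul i G) : W → ℝ) = fun w => w.2.2 i * G w :=
    funext fun w => coordMul_apply i G w
  have h2 : HasFDerivAt (fun w : W => w.2.2 i) ((ContinuousLinearMap.proj i).comp
      ((ContinuousLinearMap.snd ℝ _ _).comp (ContinuousLinearMap.snd ℝ ℝ _)) : W →L[ℝ] ℝ) w :=
    ((ContinuousLinearMap.proj i).comp
      ((ContinuousLinearMap.snd ℝ _ _).comp
        (ContinuousLinearMap.snd ℝ ℝ _)) : W →L[ℝ] ℝ).hasFDerivAt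
  rw [h, (h2.fun_mul G.differentiableAt.hasFDerivAt).fderiv]
  simp

lemma integrable_slice (G : 𝓢(W, ℝ)) (s : ℝ) (y : V) :
    Integrable fun z : V => G (s, y, z) :=
  G.integrable_comp_of_norm_le volume (u := fun z => (s, y, z)) (by fun_prop)
    fun z => (norm_snd_le (y, z)).trans (norm_snd_le (s, y, z))

lemma hasDerivAt_integral_slice (G : 𝓢(W, ℝ)) (s : ℝ) (y : V) :
    HasDerivAt (fun s => ∫ z : V, G (s, y, z)) (∫ z : V, (∂_{((1, 0, 0) : W)} G) (s, y, z)) s := by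
  have h := G.hasFDerivAt_integral_affine volume (E := ℝ) (u := fun z : V => ((0, y, z) : W))
    (by fun_prop) (L := fun _ => ContinuousLinearMap.toSpanSingleton ℝ ((1, 0, 0) : W))
    continuous_const
    (fun z p => by
      simp [Prod.norm_def])
    (C := ‖ContinuousLinearMap.toSpanSingleton ℝ ((1, 0, 0) : W)‖)
    (fun z => le_mul_of_one_le_right (norm_nonneg _) (by linarith [norm_nonneg z])) s
  have h2 := h.2.hasDerivAt
  rw [ContinuousLinearMap.integral_apply h.1] at h2
  simpa [SchwartzMap.lineDerivOp_apply_eq_fderiv] using h2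

lemma pd_integral_slice (G : 𝓢(W, ℝ)) (s : ℝ) (i : Fin d) (y : V) :
    pd i (fun y => ∫ z : V, G (s, y, z)) y =
      ∫ z : V, (∂_{((0, Pi.single i 1, 0) : W)} G) (s, y, z) := by
  set ι : V →L[ℝ] W := (ContinuousLinearMap.inr ℝ ℝ (V × V)).comp (ContinuousLinearMap.inl ℝ V V)
  have h := G.hasFDerivAt_integral_affine volume (E := V) (u := fun z : V => ((s, 0, z) : W))
    (by fun_prop) (L := fun _ => ι)
    continuous_const
    (fun z p => by
      simp [ι, Prod.norm_def])
    (C := ‖ι‖)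
    (fun z => le_mul_of_one_le_right (norm_nonneg _) (by linarith [norm_nonneg z])) y
  have h2 := h.2
  simp only [ι, ContinuousLinearMap.comp_apply, ContinuousLinearMap.inl_apply,
    ContinuousLinearMap.inr_apply, Prod.mk_add_mk, add_zero, zero_add] at h2
  rw [pd, h2.fderiv]
  have h1 := h.1
  simp only [ι, ContinuousLinearMap.comp_apply, ContinuousLinearMap.inl_apply,
    ContinuousLinearMap.inr_apply, Prod.mk_add_mk, add_zero, zero_add] at h1
  rw [ContinuousLinearMap.integral_apply h1]
  simp [SchwartzMap.lineDerivOp_apply_eq_fderiv]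

/-- The derivation `∂_s - ∑ i, z_i ∂_{y_i}`, which differentiates along the curves
`s ↦ (s, x - s • z, z)`. -/
noncomputable def transportDeriv (G : 𝓢(W, ℝ)) : 𝓢(W, ℝ) :=
  ∂_{((1, 0, 0) : W)} G - ∑ i, coordMul i (∂_{((0, Pi.single i 1, 0) : W)} G)

lemma transportDeriv_apply (G : 𝓢(W, ℝ)) (s : ℝ) (y z : V) :
    transportDeriv G (s, y, z) = fderiv ℝ G (s, y, z) (1, -z, 0) := by
  have hz : ((1, -z, 0) : W) =
      (1, 0, 0) - ∑ i, z i • ((0, Pi.single i 1, 0) : W) := by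
    refine Prod.ext ?_ (Prod.ext ?_ ?_)
    · simp [Prod.fst_sum]
    · simp only [Prod.snd_sub, Prod.fst_sub, Prod.snd_sum, Prod.fst_sum, Prod.smul_snd,
        Prod.smul_fst, zero_sub]
      congr 1
      exact pi_eq_sum_univ' z
    · simp [Prod.snd_sum]
  rw [hz, map_sub, map_sum, transportDeriv]
  simp only [_root_.sub_apply, _root_.sum_apply, coordMul_apply,
    SchwartzMap.lineDerivOp_apply_eq_fderiv, map_smul, smul_eq_mul]

lemma hasDerivAt_integral_transport (G : 𝓢(W, ℝ)) (x : V) (s : ℝ) :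
    HasDerivAt (fun s => ∫ z : V, G (s, x - s • z, z))
      (∫ z : V, transportDeriv G (s, x - s • z, z)) s := by
  have hc : Continuous fun z : V => ((1, -z, 0) : W) := by fun_prop
  have h := G.hasFDerivAt_integral_affine volume (E := ℝ) (u := fun z : V => ((0, x, z) : W))
    (by fun_prop) (L := fun z => ContinuousLinearMap.toSpanSingleton ℝ ((1, -z, 0) : W))
    ((ContinuousLinearMap.toSpanSingletonCLE (𝕜 := ℝ) (E := W)).continuous.comp hc)
    (fun z p => by
      simp [Prod.norm_def])
    (C := 1)
    (fun z => by
      rw [ContinuousLinearMap.norm_toSpanSingleton]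
      simp [Prod.norm_def]) s
  have h2 := h.2.hasDerivAt
  rw [ContinuousLinearMap.integral_apply h.1] at h2
  simpa [transportDeriv_apply, sub_eq_add_neg] using h2

lemma transportDeriv_transportDeriv (G : 𝓢(W, ℝ)) :
    transportDeriv (transportDeriv G) =
      ∂_{((1, 0, 0) : W)} (∂_{((1, 0, 0) : W)} G)
      - (2 : ℝ) • ∑ i, ∂_{((0, Pi.single i 1, 0) : W)} (∂_{((1, 0, 0) : W)} (coordMul i G))
      + ∑ i, ∑ j, ∂_{((0, Pi.single i 1, 0) : W)} (∂_{((0, Pi.single j 1, 0) : W)}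
          (coordMul i (coordMul j G))) := by
  have hsub : ∀ (e : W) (G H : 𝓢(W, ℝ)), ∂_{e} (G - H) = ∂_{e} G - ∂_{e} H := fun e G H =>
    map_sub (LineDeriv.lineDerivOpCLM ℝ 𝓢(W, ℝ) e) G H
  have hsum : ∀ (e : W) (g : Fin d → 𝓢(W, ℝ)), ∂_{e} (∑ i, g i) = ∑ i, ∂_{e} (g i) := fun e g =>
    map_sum (LineDeriv.lineDerivOpCLM ℝ 𝓢(W, ℝ) e) g _
  simp only [transportDeriv, hsub, hsum, map_sub, map_sum, lineDerivOp_coordMul,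
    Finset.sum_sub_distrib, SchwartzMap.lineDerivOp_comm G _ (1, 0, 0), two_smul]
  abel

/-- Second order expansion of `∫ G (s, x - s • z, z) dz` as `s → 0⁺`, in terms of the moments of
`G (s, y, ·)`. -/
lemma tendsto_integral_transport_sub_div_sq (G : 𝓢(W, ℝ)) (x : V)
    {M₀ : V → ℝ} {M₁ : Fin d → V → ℝ} {M₂ : Fin d → Fin d → V → ℝ}
    (heven : ∀ᶠ s in nhds (0 : ℝ), ∀ y z, G (-s, y, -z) = G (s, y, z))
    (h₀ : ∀ᶠ s in nhds (0 : ℝ), ∀ y, ∫ z : V, G (s, y, z) = M₀ y)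
    (h₁ : ∀ i, ∀ᶠ s in nhds (0 : ℝ), ∀ y, ∫ z : V, z i * G (s, y, z) = s * M₁ i y)
    (h₂ : ∀ i j y, ∫ z : V, z i * (z j * G (0, y, z)) = M₂ i j y) :
    Filter.Tendsto (fun s : ℝ => ((∫ z : V, G (s, x - s • z, z)) - M₀ x) / s ^ 2)
      (nhdsWithin 0 (Set.Ioi 0))
      (nhds (-(∑ i, pd i (M₁ i) x) + (1 / 2) * ∑ i, ∑ j, pd i (pd j (M₂ i j)) x)) := by
  have hΦ := hasDerivAt_integral_transport G x
  have hΦ' := hasDerivAt_integral_transport (transportDeriv G) x 0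
  have hzero : ∫ z : V, transportDeriv G (0, x - (0 : ℝ) • z, z) = 0 := by
    have h1 := hΦ 0
    have h2 : HasDerivAt (fun s : ℝ => ∫ z : V, G (-s, x - (-s) • z, z))
        (-∫ z : V, transportDeriv G (0, x - (0 : ℝ) • z, z)) 0 := by
      have := HasDerivAt.scomp (0 : ℝ) (h := fun s : ℝ => -s) (h' := -1)
        (by rw [neg_zero]; exact h1) (hasDerivAt_neg 0)
      simpa [Function.comp_def] using this
    have h3 : (fun s : ℝ => ∫ z : V, G (-s, x - (-s) • z, z)) =ᶠ[nhds 0]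
        fun s => ∫ z : V, G (s, x - s • z, z) := by
      filter_upwards [heven] with s hs
      rw [← integral_neg_eq_self]
      simp [hs]
    have := (h2.congr_of_eventuallyEq h3.symm).unique h1
    linarith
  have h0x : ∫ z : V, G (0, x - (0 : ℝ) • z, z) = M₀ x := by
    simpa using h₀.self_of_nhds x
  have hss : ∫ z : V, (∂_{((1, 0, 0) : W)} (∂_{((1, 0, 0) : W)} G)) (0, x, z) = 0 := by
    refine (hasDerivAt_integral_slice (∂_{((1, 0, 0) : W)} G) 0 x).unique ?_
    refine (hasDerivAt_const (0 : ℝ) (0 : ℝ)).congr_of_eventuallyEq ?_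
    filter_upwards [h₀.eventually_nhds] with s hs
    refine (hasDerivAt_integral_slice G s x).unique ?_
    refine (hasDerivAt_const s (M₀ x)).congr_of_eventuallyEq ?_
    filter_upwards [hs] with t ht using ht x
  have hsi : ∀ i y, ∫ z : V, (∂_{((1, 0, 0) : W)} (coordMul i G)) (0, y, z) = M₁ i y := by
    intro i y
    refine (hasDerivAt_integral_slice (coordMul i G) 0 y).unique ?_
    have : HasDerivAt (fun s : ℝ => s * M₁ i y) (M₁ i y) 0 := by
      simpa using (hasDerivAt_id (0 : ℝ)).mul_const (M₁ i y)
    refine this.congr_of_eventuallyEq ?_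
    filter_upwards [h₁ i] with s hs
    simpa [coordMul_apply] using hs y
  have hii : ∀ i j y, ∫ z : V, (coordMul i (coordMul j G)) (0, y, z) = M₂ i j y := fun i j y => by
    simpa [coordMul_apply] using h₂ i j y
  have hval : ∫ z : V, transportDeriv (transportDeriv G) (0, x - (0 : ℝ) • z, z) =
      -(2 * ∑ i, pd i (M₁ i) x) + ∑ i, ∑ j, pd i (pd j (M₂ i j)) x := by
    have e1 : ∀ i, pd i (M₁ i) x = ∫ z : V, (∂_{((0, Pi.single i 1, 0) : W)}
        (∂_{((1, 0, 0) : W)} (coordMul i G))) (0, x, z) := fun i => by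
      rw [← pd_integral_slice]; simp_rw [hsi]
    have e2 : ∀ i j, pd i (pd j (M₂ i j)) x = ∫ z : V, (∂_{((0, Pi.single i 1, 0) : W)}
        (∂_{((0, Pi.single j 1, 0) : W)} (coordMul i (coordMul j G)))) (0, x, z) := fun i j => by
      rw [← pd_integral_slice]
      congr 1
      funext y
      rw [← pd_integral_slice]
      simp_rw [hii]
    simp only [e1, e2, transportDeriv_transportDeriv, zero_smul, sub_zero]
    let J : 𝓢(W, ℝ) →ₗ[ℝ] ℝ :=
      { toFun := fun H => ∫ z : V, H (0, x, z)
        map_add' := fun H K => integral_add (integrable_slice H 0 x) (integrable_slice K 0 x)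
        map_smul' := fun c H => integral_const_mul c _ }
    have hJ : ∀ H : 𝓢(W, ℝ), ∫ z : V, H (0, x, z) = J H := fun H => rfl
    simp only [hJ] at hss ⊢
    simp only [map_add, map_sub, map_smul, map_sum, hss, smul_eq_mul, zero_sub]
  have := tendsto_sub_div_sq_of_hasDerivAt hΦ hzero hΦ'
  rw [h0x, hval] at this
  convert this using 2
  ring

end Second

section Gaussian

variable {d : ℕ}

local notation "V" => Fin d → ℝ

lemma Function.HasTemperateGrowth.pi_apply (i : Fin d) :
    Function.HasTemperateGrowth fun z : V => z i :=
  (ContinuousLinearMap.proj i : V →L[ℝ] ℝ).hasTemperateGrowth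

lemma norm_sq_le_sum_sq (z : V) : ‖z‖ ^ 2 ≤ ∑ i, z i ^ 2 := by
  have h0 : 0 ≤ ∑ i, z i ^ 2 := by positivity
  refine (Real.le_sqrt (norm_nonneg _) h0).1 ?_
  refine (pi_norm_le_iff_of_nonneg (Real.sqrt_nonneg _)).2 fun i => ?_
  refine Real.le_sqrt_of_sq_le ?_
  rw [Real.norm_eq_abs, sq_abs]
  exact Finset.single_le_sum (f := fun i => z i ^ 2) (fun i _ => sq_nonneg _) (Finset.mem_univ i)

lemma exists_schwartzMap_gaussian {B : Matrix (Fin d) (Fin d) ℝ} {c : ℝ} (hc : 0 < c)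
    (hB : ∀ v : V, c * ∑ i, v i ^ 2 ≤ v ⬝ᵥ (B *ᵥ v)) :
    ∃ S : 𝓢(V, ℝ), ∀ z, S z = Real.exp (-(z ⬝ᵥ (B *ᵥ z)) / 2) := by
  have hq : Function.HasTemperateGrowth fun z : V => ∑ i, ∑ j, B i j / 2 * (z i * z j) :=
    .sum fun i _ => .sum fun j _ => (Function.HasTemperateGrowth.const _).mul
      ((Function.HasTemperateGrowth.pi_apply i).mul (.pi_apply j))
  have heq : ∀ z : V, ∑ i, ∑ j, B i j / 2 * (z i * z j) = z ⬝ᵥ (B *ᵥ z) / 2 := fun z => by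
    simp only [dotProduct, mulVec, Finset.sum_div, Finset.mul_sum]
    refine Finset.sum_congr rfl fun i _ => Finset.sum_congr rfl fun j _ => ?_
    ring
  obtain ⟨S, hS⟩ := exists_schwartzMap_exp_neg hq (half_pos hc) fun z => by
    rw [heq]
    have h1 := hB z
    have h2 := mul_le_mul_of_nonneg_left (norm_sq_le_sum_sq z) hc.le
    linarith
  exact ⟨S, fun z => by rw [hS, heq, neg_div]⟩

lemma integral_exp_neg_dotProduct_self :
    ∫ u : V, Real.exp (-(u ⬝ᵥ u) / 2) = (2 * Real.pi) ^ ((d : ℝ) / 2) := by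
  have h : ∀ u : V, Real.exp (-(u ⬝ᵥ u) / 2) = ∏ i, Real.exp (-(1 / 2) * u i ^ 2) := fun u => by
    rw [← Real.exp_sum, dotProduct, ← Finset.mul_sum]
    congr 1
    simp_rw [← sq]
    ring
  simp_rw [h]
  rw [integral_fintype_prod_volume_eq_prod
    (fun _ : Fin d => fun t : ℝ => Real.exp (-(1 / 2) * t ^ 2))]
  simp only [integral_gaussian, Finset.prod_const, Finset.card_univ, Fintype.card_fin]
  rw [Real.sqrt_eq_rpow, ← Real.rpow_natCast, ← Real.rpow_mul (by positivity)]
  congr 1 <;> ring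

open scoped MatrixOrder in
lemma integral_exp_neg_inv_quadratic {A : Matrix (Fin d) (Fin d) ℝ} (hA : A.PosDef) :
    ∫ z : V, Real.exp (-(z ⬝ᵥ (A⁻¹ *ᵥ z)) / 2) =
      (2 * Real.pi) ^ ((d : ℝ) / 2) * Real.sqrt A.det := by
  obtain ⟨C, hC⟩ := CStarAlgebra.nonneg_iff_eq_star_mul_self.mp hA.inv.posSemidef.nonneg
  have hdet : A.det⁻¹ = C.det ^ 2 := by
    have h := congrArg Matrix.det hC
    rw [det_nonsing_inv, Ring.inverse_eq_inv', star_eq_conjTranspose, det_mul,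
      det_conjTranspose] at h
    rw [h]
    simp [sq]
  have hC0 : C.det ≠ 0 := fun h0 => by
    rw [h0] at hdet
    simp [hA.det_pos.ne'] at hdet
  have hquad : ∀ z : V, z ⬝ᵥ (A⁻¹ *ᵥ z) = (toLin' C z) ⬝ᵥ (toLin' C z) := fun z => by
    rw [hC, star_eq_conjTranspose, conjTranspose_eq_transpose_of_trivial, ← mulVec_mulVec,
      dotProduct_mulVec, vecMul_transpose, toLin'_apply]
  have hcont : Continuous (toLin' C) := LinearMap.continuous_of_finiteDimensional _
  simp_rw [hquad]
  rw [← integral_map (μ := volume) (φ := toLin' C)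
    (f := fun u : V => Real.exp (-(u ⬝ᵥ u) / 2)) hcont.aemeasurable
    (by simp only [dotProduct]; fun_prop), Real.map_matrix_volume_pi_eq_smul_volume_pi hC0,
    integral_smul_measure, integral_exp_neg_dotProduct_self,
    ENNReal.toReal_ofReal (abs_nonneg _), smul_eq_mul, mul_comm]
  congr 1
  rw [abs_inv, ← Real.sqrt_sq_eq_abs, ← hdet, Real.sqrt_inv, inv_inv]

lemma integral_mul_exp_neg_quadratic (B : Matrix (Fin d) (Fin d) ℝ) (i : Fin d) :
    ∫ z : V, z i * Real.exp (-(z ⬝ᵥ (B *ᵥ z)) / 2) = 0 := by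
  have h := integral_neg_eq_self (fun z : V => z i * Real.exp (-(z ⬝ᵥ (B *ᵥ z)) / 2)) volume
  simp only [Pi.neg_apply, mulVec_neg, dotProduct_neg, neg_dotProduct, neg_neg, neg_mul,
    integral_neg] at h
  linarith

lemma fderiv_exp_neg_quadratic_single {B : Matrix (Fin d) (Fin d) ℝ} (hB : Bᵀ = B) (z : V)
    (i : Fin d) :
    fderiv ℝ (fun z : V => Real.exp (-(z ⬝ᵥ (B *ᵥ z)) / 2)) z (Pi.single i 1) =
      -(B *ᵥ z) i * Real.exp (-(z ⬝ᵥ (B *ᵥ z)) / 2) := by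
  have hexp : ∀ t : ℝ, (z + t • Pi.single i 1) ⬝ᵥ (B *ᵥ (z + t • Pi.single i 1)) =
      z ⬝ᵥ (B *ᵥ z) + t * (2 * (B *ᵥ z) i) + t ^ 2 * B i i := fun t => by
    have h1 : z ⬝ᵥ (B *ᵥ Pi.single i 1) = (B *ᵥ z) i := by
      rw [dotProduct_mulVec, dotProduct_single, mul_one, ← mulVec_transpose, hB]
    have h2 : Pi.single i (1 : ℝ) ⬝ᵥ (B *ᵥ Pi.single i 1) = B i i := by simp
    simp only [mulVec_add, mulVec_smul, dotProduct_add, add_dotProduct, dotProduct_smul,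
      smul_dotProduct, smul_eq_mul, h1, h2, single_one_dotProduct]
    ring
  have hd : DifferentiableAt ℝ (fun z : V => Real.exp (-(z ⬝ᵥ (B *ᵥ z)) / 2)) z := by
    unfold mulVec dotProduct
    fun_prop
  rw [← hd.lineDeriv_eq_fderiv]
  refine HasDerivAt.deriv (f := fun t : ℝ => Real.exp
    (-((z + t • Pi.single i 1) ⬝ᵥ (B *ᵥ (z + t • Pi.single i 1))) / 2)) ?_
  simp only [hexp]
  have hpoly : HasDerivAt (fun t : ℝ =>
      -(z ⬝ᵥ (B *ᵥ z) + t * (2 * (B *ᵥ z) i) + t ^ 2 * B i i) / 2) (-(B *ᵥ z) i) 0 := by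
    have := ((((hasDerivAt_id (0 : ℝ)).mul_const (2 * (B *ᵥ z) i)).const_add
      (z ⬝ᵥ (B *ᵥ z))).add ((hasDerivAt_pow 2 (0 : ℝ)).mul_const (B i i))).neg.div_const 2
    exact this.congr_deriv (by simp; ring)
  exact hpoly.exp.congr_deriv (by simp [mul_comm])

lemma integral_mul_mul_exp_neg_inv_quadratic {A : Matrix (Fin d) (Fin d) ℝ} (hA : A.PosDef)
    {c : ℝ} (hc : 0 < c) (hB : ∀ v : V, c * ∑ i, v i ^ 2 ≤ v ⬝ᵥ (A⁻¹ *ᵥ v)) (i j : Fin d) :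
    ∫ z : V, z i * (z j * Real.exp (-(z ⬝ᵥ (A⁻¹ *ᵥ z)) / 2)) =
      (2 * Real.pi) ^ ((d : ℝ) / 2) * Real.sqrt A.det * A i j := by
  have hsymm : A⁻¹ᵀ = A⁻¹ := by
    simpa [conjTranspose_eq_transpose_of_trivial] using hA.inv.isHermitian.eq
  obtain ⟨γ, hγ⟩ := exists_schwartzMap_gaussian hc hB
  have hγ' : (γ : V → ℝ) = fun z => Real.exp (-(z ⬝ᵥ (A⁻¹ *ᵥ z)) / 2) := funext hγ
  have hmul : ∀ (i : Fin d) (S : 𝓢(V, ℝ)), Integrable fun z : V => z i * S z := fun i S =>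
    (SchwartzMap.smulLeftCLM ℝ (fun z : V => z i) S).integrable.congr
      (.of_forall fun z => SchwartzMap.smulLeftCLM_apply_apply (.pi_apply i) S z)
  have hmul₂ : ∀ i j : Fin d, Integrable fun z : V => z i * (z j * γ z) := fun i j =>
    (hmul i (SchwartzMap.smulLeftCLM ℝ (fun z : V => z j) γ)).congr (.of_forall fun z => by
      simp [SchwartzMap.smulLeftCLM_apply_apply (.pi_apply j)])
  have hfd : ∀ (k : Fin d) (z : V), fderiv ℝ γ z (Pi.single k 1) = -(A⁻¹ *ᵥ z) k * γ z :=
    fun k z => by rw [hγ', fderiv_exp_neg_quadratic_single hsymm]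
  have hfc : ∀ (k : Fin d) (z : V), fderiv ℝ (fun z : V => z j) z (Pi.single k 1) =
      (1 : Matrix (Fin d) (Fin d) ℝ) k j := fun k z => by
    have : HasFDerivAt (fun z : V => z j) (ContinuousLinearMap.proj j : V →L[ℝ] ℝ) z :=
      (ContinuousLinearMap.proj j : V →L[ℝ] ℝ).hasFDerivAt
    rw [this.fderiv]
    simp [one_apply, Pi.single_apply, eq_comm]
  have hbp : ∀ k, ∑ l, A⁻¹ k l * ∫ z : V, z l * (z j * γ z) =
      (1 : Matrix (Fin d) (Fin d) ℝ) k j * ∫ z : V, γ z := fun k => by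
    have h := integral_mul_fderiv_eq_neg_fderiv_mul_of_integrable (μ := (volume : Measure V))
      (f := fun z : V => z j) (g := γ) (v := Pi.single k 1)
      (by simp only [hfc]; exact γ.integrable.const_mul _)
      (hmul j (∂_{(Pi.single k 1 : V)} γ))
      (hmul j γ) (fun z _ => by fun_prop) (fun z _ => γ.differentiableAt)
    simp only [hfc, hfd, integral_const_mul] at h
    rw [← neg_inj, ← h]
    simp_rw [← integral_const_mul]
    rw [← integral_finsetSum _ fun l _ => (hmul₂ l j).const_mul _, ← integral_neg]
    refine integral_congr_ae (.of_forall fun z => ?_)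
    simp only [mulVec, dotProduct, mul_neg, neg_mul, Finset.sum_mul, Finset.mul_sum]
    rw [neg_inj]
    exact Finset.sum_congr rfl fun l _ => by ring
  set S : Matrix (Fin d) (Fin d) ℝ := of fun l _ => ∫ z : V, z l * (z j * γ z)
  have hBS : ∀ k, (A⁻¹ * S) k j = (1 : Matrix (Fin d) (Fin d) ℝ) k j * ∫ z : V, γ z := fun k => by
    rw [mul_apply]; exact hbp k
  have hS : S = A * (A⁻¹ * S) := by
    rw [← Matrix.mul_assoc, mul_nonsing_inv _ hA.det_pos.ne'.isUnit, Matrix.one_mul]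
  have hval : S i j = A i j * ∫ z : V, γ z := by
    conv_lhs => rw [hS, mul_apply]
    simp [hBS, one_apply]
  rw [mul_comm, ← integral_exp_neg_inv_quadratic hA]
  simpa [S, hγ] using hval

end Gaussian

section Cutoff

variable {d : ℕ}

local notation "V" => Fin d → ℝ
local notation "W" => ℝ × (Fin d → ℝ) × (Fin d → ℝ)

lemma exists_schwartzMap_shifted_gaussian {Q : V → Matrix (Fin d) (Fin d) ℝ} {β : V → V}
    {c R : ℝ} (hQ : ∀ i j, Function.HasTemperateGrowth fun y => Q y i j)
    (hβ : ∀ i, Function.HasTemperateGrowth fun y => β y i) (hc : 0 < c)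
    (hQc : ∀ y (v : V), c * ∑ i, v i ^ 2 ≤ v ⬝ᵥ (Q y *ᵥ v)) (hR : ∀ y i, |β y i| ≤ R) :
    ∃ (M : ℝ) (S : 𝓢(W, ℝ)), ∀ s y z, S (s, y, z) =
      Real.exp (-((z - s • β y) ⬝ᵥ (Q y *ᵥ (z - s • β y))) / 2 -
        (M * s ^ 2 + ∑ k, y k ^ 2)) := by
  have hs : Function.HasTemperateGrowth fun w : W => w.1 :=
    (ContinuousLinearMap.fst ℝ ℝ (V × V)).hasTemperateGrowth
  have hy : Function.HasTemperateGrowth fun w : W => w.2.1 :=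
    ((ContinuousLinearMap.fst ℝ V V).comp
      (ContinuousLinearMap.snd ℝ ℝ (V × V))).hasTemperateGrowth
  have hz : Function.HasTemperateGrowth fun w : W => w.2.2 :=
    ((ContinuousLinearMap.snd ℝ V V).comp
      (ContinuousLinearMap.snd ℝ ℝ (V × V))).hasTemperateGrowth
  have hv : ∀ i, Function.HasTemperateGrowth fun w : W => w.2.2 i - w.1 * β w.2.1 i := fun i =>
    ((Function.HasTemperateGrowth.pi_apply i).comp hz).sub (hs.mul ((hβ i).comp hy))
  set M : ℝ := c * (d * R ^ 2) / 2 + 1 with hM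
  set q : W → ℝ := fun w => (∑ i, (w.2.2 i - w.1 * β w.2.1 i) *
    ∑ j, Q w.2.1 i j * (w.2.2 j - w.1 * β w.2.1 j)) * (1 / 2) +
      (M * w.1 ^ 2 + ∑ k, w.2.1 k ^ 2) with hq
  have hqt : q.HasTemperateGrowth :=
    ((Function.HasTemperateGrowth.sum fun i _ => (hv i).mul
      (.sum fun j _ => ((hQ i j).comp hy).mul (hv j))).mul (.const _)).add
      (((Function.HasTemperateGrowth.const M).mul (hs.pow 2)).add
        (.sum fun k _ => ((Function.HasTemperateGrowth.pi_apply k).comp hy).pow 2))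
  have hqe : ∀ s y z, q (s, y, z) = ((z - s • β y) ⬝ᵥ (Q y *ᵥ (z - s • β y))) / 2 +
      (M * s ^ 2 + ∑ k, y k ^ 2) := fun s y z => by
    simp only [hq, dotProduct, mulVec, Pi.sub_apply, Pi.smul_apply, smul_eq_mul]
    ring
  obtain ⟨S, hS⟩ := exists_schwartzMap_exp_neg hqt (c := min (c / 4) 1) (by positivity)
    fun ⟨s, y, z⟩ => by
      have h1 := hQc y (z - s • β y)
      have h2 : (∑ i, z i ^ 2) / 2 - s ^ 2 * (d * R ^ 2) ≤ ∑ i, (z - s • β y) i ^ 2 := by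
        have : (∑ i, z i ^ 2) / 2 - s ^ 2 * (d * R ^ 2) =
            ∑ i, (z i ^ 2 / 2 - s ^ 2 * R ^ 2) := by
          rw [Finset.sum_sub_distrib, Finset.sum_div]
          simp
          ring
        rw [this]
        refine Finset.sum_le_sum fun i _ => ?_
        have hb : β y i ^ 2 ≤ R ^ 2 := sq_le_sq' (abs_le.1 (hR y i)).1 (abs_le.1 (hR y i)).2
        simp only [Pi.sub_apply, Pi.smul_apply, smul_eq_mul]
        nlinarith [sq_nonneg (z i - 2 * (s * β y i)), mul_le_mul_of_nonneg_left hb (sq_nonneg s)]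
      have h3 := mul_le_mul_of_nonneg_left h2 hc.le
      have h4 : c / 4 * ∑ i, z i ^ 2 + s ^ 2 + ∑ k, y k ^ 2 ≤ q (s, y, z) := by
        rw [hqe, hM]
        linarith
      have h5 : ‖((s, y, z) : W)‖ ^ 2 ≤ max (s ^ 2) (max (∑ k, y k ^ 2) (∑ i, z i ^ 2)) := by
        rw [Prod.norm_mk, Prod.norm_mk]
        rcases max_choice ‖s‖ (max ‖y‖ ‖z‖) with h | h <;> rw [h]
        · simp
        · rcases max_choice ‖y‖ ‖z‖ with h | h <;> rw [h]
          · simp [norm_sq_le_sum_sq]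
          · simp [norm_sq_le_sum_sq]
      have hy0 : 0 ≤ ∑ k, y k ^ 2 := by positivity
      have hz0 : 0 ≤ ∑ k, z k ^ 2 := by positivity
      have hm0 : 0 ≤ min (c / 4) 1 := by positivity
      refine ((mul_le_mul_of_nonneg_left h5 hm0).trans ?_).trans h4
      have hs0 := sq_nonneg s
      have hcz : 0 ≤ c / 4 * ∑ k, z k ^ 2 := by positivity
      rcases max_choice (s ^ 2) (max (∑ k, y k ^ 2) (∑ i, z i ^ 2)) with h | h <;> rw [h]
      · nlinarith [min_le_right (c / 4) 1]
      · rcases max_choice (∑ k, y k ^ 2) (∑ i, z i ^ 2) with h | h <;> rw [h]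
        · nlinarith [min_le_right (c / 4) 1]
        · nlinarith [min_le_left (c / 4) 1]
  refine ⟨M, S, fun s y z => ?_⟩
  rw [hS, hqe]
  congr 1
  ring

lemma exists_schwartzMap_eventually_eq_gaussian {B : V → Matrix (Fin d) (Fin d) ℝ} {b : V → V}
    {f : V → ℝ} {c : ℝ} (hB : ∀ i j, ContDiff ℝ ∞ fun y => B y i j) (hb : ContDiff ℝ ∞ b)
    (hf : ContDiff ℝ ∞ f) (hfc : HasCompactSupport f) (hc : 0 < c)
    (hBc : ∀ y (v : V), c * ∑ i, v i ^ 2 ≤ v ⬝ᵥ (B y *ᵥ v)) :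
    ∃ G : 𝓢(W, ℝ), ∀ᶠ s in nhds (0 : ℝ), ∀ y z, G (s, y, z) =
      Real.exp (-((z - s • b y) ⬝ᵥ (B y *ᵥ (z - s • b y))) / 2) * f y := by
  obtain ⟨r, hr, hfr⟩ : ∃ r : ℝ, 0 < r ∧ tsupport f ⊆ Metric.closedBall 0 r := by
    obtain ⟨r, hr⟩ := hfc.isBounded.subset_closedBall 0
    exact ⟨max r 1, by positivity, hr.trans (Metric.closedBall_subset_closedBall (le_max_left _ _))⟩
  let ψ : ContDiffBump (0 : V) := ⟨r, r + 1, hr, by linarith⟩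
  have hψ : ∀ y, f y ≠ 0 → ψ y = 1 := fun y hy =>
    ψ.one_of_mem_closedBall (hfr (subset_tsupport f hy))
  have hψt : ∀ g : V → ℝ, ContDiff ℝ ∞ g → Function.HasTemperateGrowth fun y => ψ y * g y :=
    fun g hg => (ψ.hasCompactSupport.mul_right (f' := g)).hasTemperateGrowth (ψ.contDiff.mul hg)
  have hbi : ∀ i, ContDiff ℝ ∞ fun y => b y i := contDiff_pi.1 hb
  set Q : V → Matrix (Fin d) (Fin d) ℝ := fun y =>
    of fun i j => ψ y * (B y i j - c * (1 : Matrix (Fin d) (Fin d) ℝ) i j) +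
      c * (1 : Matrix (Fin d) (Fin d) ℝ) i j with hQ
  have hQe : ∀ y, Q y = ψ y • B y + ((1 - ψ y) * c) • 1 := fun y => by
    ext i j
    simp [hQ]
    ring
  have hQc : ∀ y (v : V), c * ∑ i, v i ^ 2 ≤ v ⬝ᵥ (Q y *ᵥ v) := fun y v => by
    have h1 := mul_le_mul_of_nonneg_left (hBc y v) (ψ.nonneg (x := y))
    have h2 : v ⬝ᵥ v = ∑ i, v i ^ 2 := by simp [dotProduct, sq]
    rw [hQe, add_mulVec, dotProduct_add, smul_mulVec, smul_mulVec, one_mulVec, dotProduct_smul,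
      dotProduct_smul, h2, smul_eq_mul, smul_eq_mul]
    linarith
  obtain ⟨R, hR⟩ := ((ψ.hasCompactSupport.smul_right (f' := b))).exists_bound_of_continuous
    (ψ.continuous.smul hb.continuous)
  obtain ⟨M, S, hS⟩ := exists_schwartzMap_shifted_gaussian (Q := Q) (β := fun y => ψ y • b y)
    (fun i j => (hψt _ ((hB i j).sub contDiff_const)).add (.const _)) (fun i => hψt _ (hbi i)) hc
    hQc (fun y i => (norm_le_pi_norm (ψ y • b y) i).trans (hR y))
  let χ : ContDiffBump (0 : ℝ) := ⟨1, 2, one_pos, one_lt_two⟩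
  have hχt : Function.HasTemperateGrowth fun s : ℝ => χ s * Real.exp (M * s ^ 2) :=
    (χ.hasCompactSupport.mul_right (f' := fun s => Real.exp (M * s ^ 2))).hasTemperateGrowth
      (χ.contDiff.mul (by fun_prop))
  have hft : Function.HasTemperateGrowth fun y : V => f y * Real.exp (∑ k, y k ^ 2) :=
    (hfc.mul_right (f' := fun y : V => Real.exp (∑ k, y k ^ 2))).hasTemperateGrowth
      (hf.mul (by fun_prop))
  have ht : Function.HasTemperateGrowth fun w : W =>
      χ w.1 * Real.exp (M * w.1 ^ 2) * (f w.2.1 * Real.exp (∑ k, w.2.1 k ^ 2)) :=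
    (hχt.comp (ContinuousLinearMap.fst ℝ ℝ (V × V)).hasTemperateGrowth).mul
      (hft.comp ((ContinuousLinearMap.fst ℝ V V).comp
        (ContinuousLinearMap.snd ℝ ℝ (V × V))).hasTemperateGrowth)
  refine ⟨SchwartzMap.smulLeftCLM ℝ (fun w : W => χ w.1 * Real.exp (M * w.1 ^ 2) *
    (f w.2.1 * Real.exp (∑ k, w.2.1 k ^ 2))) S, ?_⟩
  filter_upwards [Metric.closedBall_mem_nhds (0 : ℝ) one_pos] with s hs y z
  rw [SchwartzMap.smulLeftCLM_apply_apply ht, hS]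
  simp only [χ.one_of_mem_closedBall hs, smul_eq_mul, one_mul]
  by_cases hy : f y = 0
  · simp [hy]
  · have hQB : Q y = B y := by simp [hQe, hψ y hy]
    rw [hQB, hψ y hy, one_smul, Real.exp_sub, Real.exp_add]
    field_simp

lemma contDiff_nonsing_inv_apply {A : V → Matrix (Fin d) (Fin d) ℝ}
    (hA : ∀ i j, ContDiff ℝ ∞ fun y => A y i j) (hdet : ∀ y, (A y).det ≠ 0) (i j : Fin d) :
    ContDiff ℝ ∞ fun y => (A y)⁻¹ i j := by
  have hdetc : ∀ C : V → Matrix (Fin d) (Fin d) ℝ, (∀ i j, ContDiff ℝ ∞ fun y => C y i j) →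
      ContDiff ℝ ∞ fun y => (C y).det := fun C hC => by
    simp only [det_apply']
    exact ContDiff.sum fun σ _ => contDiff_const.mul (contDiff_prod fun k _ => hC _ _)
  simp only [inv_def, Ring.inverse_eq_inv', Matrix.smul_apply, smul_eq_mul, adjugate_apply]
  refine ((hdetc A hA).inv hdet).mul
    (hdetc (fun y => (A y).updateRow j (Pi.single i 1)) fun k l => ?_)
  simp only [updateRow_apply]
  split_ifs
  · exact contDiff_const
  · exact hA k l

lemma le_dotProduct_inv_mulVec {A : Matrix (Fin d) (Fin d) ℝ} (hA : A.PosDef) {L : ℝ} (hL : 0 < L)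
    (hle : ∀ v : V, v ⬝ᵥ (A *ᵥ v) ≤ L * ∑ i, v i ^ 2) (v : V) :
    L⁻¹ * ∑ i, v i ^ 2 ≤ v ⬝ᵥ (A⁻¹ *ᵥ v) := by
  have hsymm : Aᵀ = A := by simpa [conjTranspose_eq_transpose_of_trivial] using hA.isHermitian.eq
  set w : V := A⁻¹ *ᵥ v with hw
  have hAw : A *ᵥ w = v := by
    rw [hw, mulVec_mulVec, mul_nonsing_inv _ hA.det_pos.ne'.isUnit, one_mulVec]
  have hpos := hA.posSemidef.dotProduct_mulVec_nonneg (w - L⁻¹ • v)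
  have h1 : w ⬝ᵥ (A *ᵥ v) = v ⬝ᵥ v := by
    rw [dotProduct_mulVec, ← mulVec_transpose, hsymm, hAw]
  have h2 : v ⬝ᵥ v = ∑ i, v i ^ 2 := by simp [dotProduct, sq]
  simp only [star_trivial, mulVec_sub, mulVec_smul, hAw, dotProduct_sub, sub_dotProduct,
    smul_dotProduct, dotProduct_smul, smul_eq_mul, h1, h2] at hpos
  have h3 : L⁻¹ * (L⁻¹ * (v ⬝ᵥ (A *ᵥ v))) ≤ L⁻¹ * ∑ i, v i ^ 2 := by
    have := hle v
    gcongr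
    rwa [inv_mul_le_iff₀ hL]
  rw [dotProduct_comm w v] at hpos
  linarith

end Cutoff

section Transport

variable {d : ℕ}

local notation "V" => Fin d → ℝ

lemma rpow_mul_integral_kernel_eq (B : V → Matrix (Fin d) (Fin d) ℝ) (b : V → V) (f : V → ℝ)
    (x : V) {s : ℝ} (hs : 0 < s) :
    (s ^ 2) ^ (-(d : ℝ) / 2) * ∫ y : V,
        Real.exp (-((x - y - s ^ 2 • b y) ⬝ᵥ (B y *ᵥ (x - y - s ^ 2 • b y))) / (2 * s ^ 2)) * f y =
      ∫ z : V, Real.exp (-((z - s • b (x - s • z)) ⬝ᵥ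
        (B (x - s • z) *ᵥ (z - s • b (x - s • z)))) / 2) * f (x - s • z) := by
  set F : V → ℝ := fun y =>
    Real.exp (-((x - y - s ^ 2 • b y) ⬝ᵥ (B y *ᵥ (x - y - s ^ 2 • b y))) / (2 * s ^ 2)) * f y
  have hF : ∀ z, Real.exp (-((z - s • b (x - s • z)) ⬝ᵥ
      (B (x - s • z) *ᵥ (z - s • b (x - s • z)))) / 2) * f (x - s • z) = F (x - s • z) :=
    fun z => by
      have h : x - (x - s • z) - s ^ 2 • b (x - s • z) = s • (z - s • b (x - s • z)) := by
        rw [smul_sub, smul_smul, sq]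
        abel
      simp only [F, h, mulVec_smul, dotProduct_smul, smul_dotProduct, smul_eq_mul]
      congr 2
      field_simp
  simp_rw [hF]
  rw [Measure.integral_comp_smul volume (fun u => F (x - u)) s, integral_sub_left_eq_self F,
    smul_eq_mul, Module.finrank_fin_fun, abs_of_pos (by positivity)]
  congr 1
  rw [← Real.rpow_natCast s 2, ← Real.rpow_mul hs.le, ← Real.rpow_natCast s d,
    ← Real.rpow_neg hs.le]
  congr 1
  push_cast
  ring

lemma integral_shifted_gaussian {A : Matrix (Fin d) (Fin d) ℝ} (hA : A.PosDef) (v : V) :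
    ∫ z : V, Real.exp (-((z - v) ⬝ᵥ (A⁻¹ *ᵥ (z - v))) / 2) =
      (2 * Real.pi) ^ ((d : ℝ) / 2) * Real.sqrt A.det := by
  rw [integral_sub_right_eq_self (fun z : V => Real.exp (-(z ⬝ᵥ (A⁻¹ *ᵥ z)) / 2)) v,
    integral_exp_neg_inv_quadratic hA]

lemma integral_mul_shifted_gaussian {A : Matrix (Fin d) (Fin d) ℝ} (hA : A.PosDef) {c : ℝ}
    (hc : 0 < c) (hB : ∀ v : V, c * ∑ i, v i ^ 2 ≤ v ⬝ᵥ (A⁻¹ *ᵥ v)) (v : V) (i : Fin d) :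
    ∫ z : V, z i * Real.exp (-((z - v) ⬝ᵥ (A⁻¹ *ᵥ (z - v))) / 2) =
      (2 * Real.pi) ^ ((d : ℝ) / 2) * Real.sqrt A.det * v i := by
  obtain ⟨γ, hγ⟩ := exists_schwartzMap_gaussian hc hB
  have hmul : Integrable fun z : V => z i * Real.exp (-(z ⬝ᵥ (A⁻¹ *ᵥ z)) / 2) :=
    (SchwartzMap.smulLeftCLM ℝ (fun z : V => z i) γ).integrable.congr (.of_forall fun z => by
      rw [SchwartzMap.smulLeftCLM_apply_apply (.pi_apply i), hγ, smul_eq_mul])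
  have hint : Integrable fun z : V => Real.exp (-(z ⬝ᵥ (A⁻¹ *ᵥ z)) / 2) :=
    γ.integrable.congr (.of_forall hγ)
  have h := integral_sub_right_eq_self
    (fun z : V => (z + v) i * Real.exp (-(z ⬝ᵥ (A⁻¹ *ᵥ z)) / 2)) v (μ := volume)
  simp only [sub_add_cancel] at h
  rw [h]
  simp only [Pi.add_apply, add_mul]
  rw [integral_add hmul (hint.const_mul _), integral_mul_exp_neg_quadratic, integral_const_mul,
    integral_exp_neg_inv_quadratic hA, zero_add, mul_comm]

end Transport

end Auxiliary

/-- Euclidean case of the expansion of the adjoint of a skew-free local kernel: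
the adjoint operator `G*_ε` of the prototypical kernel recovers the Fokker–Planck
operator `𝓛*` with drift `μ = m·b` and diffusion coefficient `C = m·A`, where
`m(y) = (2π)^(d/2)·(det A(y))^(1/2)`. -/
theorem adjoint_kernel_converges_to_fokker_planck
    (d : ℕ) (hd : 1 ≤ d)
    (A : (Fin d → ℝ) → Matrix (Fin d) (Fin d) ℝ) (hApos : ∀ y, (A y).PosDef)
    (hAsmooth : ∀ i j, ContDiff ℝ (⊤ : ℕ∞) (fun y => A y i j))
    (b : (Fin d → ℝ) → (Fin d → ℝ)) (hbsmooth : ContDiff ℝ (⊤ : ℕ∞) b)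
    (lam Λ : ℝ) (hlam : 0 < lam) (hlamΛ : lam ≤ Λ)
    (hbound : ∀ (y : Fin d → ℝ) (v : Fin d → ℝ),
      lam * (∑ i, v i ^ 2) ≤ v ⬝ᵥ (A y *ᵥ v) ∧ v ⬝ᵥ (A y *ᵥ v) ≤ Λ * (∑ i, v i ^ 2))
    (hbbdd : ∃ M : ℝ, ∀ y i, |b y i| ≤ M)
    (hAderivbdd : ∀ n : ℕ, 1 ≤ n → ∀ i j,
      ∃ M : ℝ, ∀ y, ‖iteratedFDeriv ℝ n (fun z => A z i j) y‖ ≤ M)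
    (hbderivbdd : ∀ n : ℕ, 1 ≤ n → ∀ i,
      ∃ M : ℝ, ∀ y, ‖iteratedFDeriv ℝ n (fun z => b z i) y‖ ≤ M)
    (f : (Fin d → ℝ) → ℝ) (hf : ContDiff ℝ (⊤ : ℕ∞) f) (hfc : HasCompactSupport f)
    (m : (Fin d → ℝ) → ℝ)
    (hm : ∀ y, m y = (2 * Real.pi) ^ ((d : ℝ) / 2) * Real.sqrt (A y).det)
    (x : Fin d → ℝ) :
    Filter.Tendsto
      (fun ε : ℝ =>
        (1 / ε) *
          (ε ^ (-(d : ℝ) / 2) *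
            (∫ y : Fin d → ℝ,
              Real.exp (-((x - y - ε • b y) ⬝ᵥ ((A y)⁻¹ *ᵥ (x - y - ε • b y))) / (2 * ε))
                * f y)
          - m x * f x))
      (nhdsWithin 0 (Set.Ioi 0))
      (nhds (-(∑ i, pd i (fun y => m y * b y i * f y) x) +
        (1 / 2) * ∑ i, ∑ j, pd i (pd j (fun y => m y * A y i j * f y)) x)) := by
  have hΛ : 0 < Λ := hlam.trans_le hlamΛ
  have hinv : ∀ y (v : Fin d → ℝ), Λ⁻¹ * ∑ i, v i ^ 2 ≤ v ⬝ᵥ ((A y)⁻¹ *ᵥ v) := fun y =>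
    le_dotProduct_inv_mulVec (hApos y) hΛ fun v => (hbound y v).2
  have hc : 0 < Λ⁻¹ := inv_pos.2 hΛ
  obtain ⟨G, hG⟩ := exists_schwartzMap_eventually_eq_gaussian (B := fun y => (A y)⁻¹)
    (contDiff_nonsing_inv_apply hAsmooth fun y => (hApos y).det_pos.ne') hbsmooth hf hfc hc hinv
  have hlim := tendsto_integral_transport_sub_div_sq G x (M₀ := fun y => m y * f y)
    (M₁ := fun i y => m y * b y i * f y) (M₂ := fun i j y => m y * A y i j * f y)
    (by
      have hG' := (continuous_neg.tendsto' (0 : ℝ) 0 neg_zero).eventually hG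
      filter_upwards [hG, hG'] with s hs hs' y z
      rw [hs, hs']
      have : -z - -s • b y = -(z - s • b y) := by rw [neg_smul]; abel
      rw [this, mulVec_neg, neg_dotProduct_neg])
    (by
      filter_upwards [hG] with s hs y
      simp only [hs, integral_mul_const, integral_shifted_gaussian (hApos y), hm])
    (fun i => by
      filter_upwards [hG] with s hs y
      simp only [hs, ← mul_assoc, integral_mul_const,
        integral_mul_shifted_gaussian (hApos y) hc (hinv y), hm, Pi.smul_apply, smul_eq_mul]
      ring)
    (fun i j y => by
      simp only [hG.self_of_nhds, zero_smul, sub_zero, hm]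
      rw [← integral_mul_mul_exp_neg_inv_quadratic (hApos y) hc (hinv y), ← integral_mul_const]
      simp only [mul_assoc])
  have hsqrt : Filter.Tendsto Real.sqrt (nhdsWithin 0 (Set.Ioi 0)) (nhdsWithin 0 (Set.Ioi 0)) :=
    tendsto_nhdsWithin_iff.2 ⟨tendsto_nhdsWithin_of_tendsto_nhds
      (Real.continuous_sqrt.tendsto' 0 0 Real.sqrt_zero),
      by filter_upwards [self_mem_nhdsWithin] with ε hε using Real.sqrt_pos.2 hε⟩
  refine (hlim.comp hsqrt).congr' ?_
  filter_upwards [self_mem_nhdsWithin,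
    hsqrt.eventually (hG.filter_mono nhdsWithin_le_nhds)] with ε hε hGε
  have h := rpow_mul_integral_kernel_eq (fun y => (A y)⁻¹) b f x (Real.sqrt_pos.2 hε)
  rw [Real.sq_sqrt (le_of_lt hε)] at h
  simp only [Function.comp_apply, hGε]
  rw [← h, Real.sq_sqrt (le_of_lt hε), one_div, div_eq_inv_mul]
end

section
/- Let d ≥ 1, let C : ℝ^d → (symmetric positive-definite d×d real matrices) be smooth, and let f : ℝ^d → ℝ be smooth. Define ρ(x) = (det C(x))^{1/2}, Δ̂f := ρ·∑_i ∂_i( ρ⁻¹ ∑_j C_{ij} ∂_j f ), and κ_j := ∑_i ( C_{ij}·∂_i(det C)/(2·det C) − ∂_i C_{ij} ). Then at every point of ℝ^d: ∑_{i,j} ∂_i ∂_j ( C_{ij}·f ) = ρ⁻¹·Δ̂(ρ·f) − ∑_j ∂_j( κ_j·f ). (This is the adjoint part of the change-of-metric lemma in Euclidean coordinates.) -/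
open Matrix

theorem ContDiff.pd {d : ℕ} {g : (Fin d → ℝ) → ℝ} (hg : ContDiff ℝ (⊤ : ℕ∞) g) (i : Fin d) :
    ContDiff ℝ (⊤ : ℕ∞) (pd i g) :=
  (hg.fderiv_right le_rfl).clm_apply contDiff_const

theorem pd_mul {d : ℕ} {g h : (Fin d → ℝ) → ℝ} {x : Fin d → ℝ} (hg : DifferentiableAt ℝ g x)
    (hh : DifferentiableAt ℝ h x) (i : Fin d) :
    pd i (fun y => g y * h y) x = g x * pd i h x + h x * pd i g x := by
  simp [pd, fderiv_fun_mul hg hh]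

theorem pd_sub {d : ℕ} {g h : (Fin d → ℝ) → ℝ} {x : Fin d → ℝ} (hg : DifferentiableAt ℝ g x)
    (hh : DifferentiableAt ℝ h x) (i : Fin d) :
    pd i (fun y => g y - h y) x = pd i g x - pd i h x := by
  simp [pd, fderiv_fun_sub hg hh]

theorem pd_sum {d : ℕ} {ι : Type*} {s : Finset ι} {g : ι → (Fin d → ℝ) → ℝ} {x : Fin d → ℝ}
    (hg : ∀ j ∈ s, DifferentiableAt ℝ (g j) x) (i : Fin d) :
    pd i (fun y => ∑ j ∈ s, g j y) x = ∑ j ∈ s, pd i (g j) x := by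
  simp [pd, fderiv_fun_sum hg]

theorem pd_sqrt {d : ℕ} {g : (Fin d → ℝ) → ℝ} {x : Fin d → ℝ} (hg : DifferentiableAt ℝ g x)
    (hx : g x ≠ 0) (i : Fin d) :
    pd i (fun y => √(g y)) x = pd i g x / (2 * √(g x)) := by
  simp only [pd, fderiv_sqrt hg hx, _root_.smul_apply, smul_eq_mul]
  ring

theorem contDiff_matrix_det {E n : Type*} [NormedAddCommGroup E] [NormedSpace ℝ E] [Fintype n]
    [DecidableEq n] {k : WithTop ℕ∞} {A : E → Matrix n n ℝ}
    (hA : ∀ i j, ContDiff ℝ k (fun x => A x i j)) : ContDiff ℝ k (fun x => (A x).det) := by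
  simp only [Matrix.det_apply']
  exact ContDiff.sum fun σ _ => contDiff_const.mul (contDiff_prod fun i _ => hA _ _)

/-- Adjoint part of the change-of-metric lemma in Euclidean coordinates:
`∑ᵢⱼ ∂ᵢ∂ⱼ(Cᵢⱼ f) = ρ⁻¹·Δ̂(ρf) − ∑ⱼ ∂ⱼ(κⱼ f)` where `ρ = (det C)^(1/2)`, `Δ̂` is the
Laplace–Beltrami operator of the metric `ĝ = C⁻¹` and `κ` the associated drift field. -/
theorem change_of_metric_adjoint
    (d : ℕ) (hd : 1 ≤ d)
    (C : (Fin d → ℝ) → Matrix (Fin d) (Fin d) ℝ) (hCpos : ∀ x, (C x).PosDef)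
    (hCsmooth : ∀ i j, ContDiff ℝ (⊤ : ℕ∞) (fun x => C x i j))
    (f : (Fin d → ℝ) → ℝ) (hf : ContDiff ℝ (⊤ : ℕ∞) f)
    (ρ : (Fin d → ℝ) → ℝ) (hρ : ∀ x, ρ x = Real.sqrt (C x).det)
    (Δhat : ((Fin d → ℝ) → ℝ) → (Fin d → ℝ) → ℝ)
    (hΔhat : ∀ g x, Δhat g x = ρ x * ∑ i, pd i (fun y => (ρ y)⁻¹ * ∑ j, C y i j * pd j g y) x)
    (κ : Fin d → (Fin d → ℝ) → ℝ)
    (hκ : ∀ j x, κ j x = ∑ i,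
      (C x i j * pd i (fun y => (C y).det) x / (2 * (C x).det) - pd i (fun y => C y i j) x)) :
    ∀ x : Fin d → ℝ,
      ∑ i, ∑ j, pd i (pd j (fun y => C y i j * f y)) x
        = (ρ x)⁻¹ * Δhat (fun y => ρ y * f y) x - ∑ j, pd j (fun y => κ j y * f y) x := by
  have hdet_pos : ∀ x, 0 < (C x).det := fun x => (hCpos x).det_pos
  have hdet : ContDiff ℝ (⊤ : ℕ∞) (fun x => (C x).det) := contDiff_matrix_det hCsmooth
  have hsymm : ∀ x i j, C x i j = C x j i := fun x i j => by
    simpa using ((hCpos x).isHermitian.apply i j).symm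
  have hρ_pos : ∀ x, 0 < ρ x := fun x => hρ x ▸ Real.sqrt_pos.2 (hdet_pos x)
  have hρ_eq : ρ = fun x => √(C x).det := funext hρ
  have hρ_smooth : ContDiff ℝ (⊤ : ℕ∞) ρ :=
    hρ_eq ▸ hdet.sqrt fun x => (hdet_pos x).ne'
  have diff {g : (Fin d → ℝ) → ℝ} (hg : ContDiff ℝ (⊤ : ℕ∞) g) (x) : DifferentiableAt ℝ g x :=
    hg.differentiable (by simp) x
  have hpdρ : ∀ j x, (ρ x)⁻¹ * pd j ρ x = pd j (fun y => (C y).det) x / (2 * (C x).det) := by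
    intro j x
    have hsq : (C x).det = ρ x * ρ x := by rw [hρ, Real.mul_self_sqrt (hdet_pos x).le]
    have h : pd j ρ x = pd j (fun y => (C y).det) x / (2 * ρ x) := by
      rw [hρ x, ← pd_sqrt (diff hdet x) (hdet_pos x).ne', hρ_eq]
    have := (hρ_pos x).ne'
    rw [h, hsq]
    field_simp
  have hκ_smooth : ∀ j, ContDiff ℝ (⊤ : ℕ∞) (κ j) := fun j => by
    rw [funext (hκ j)]
    exact ContDiff.sum fun i _ => (((hCsmooth i j).mul (hdet.pd i)).div
      (contDiff_const.mul hdet) fun x => by simpa using (hdet_pos x).ne').sub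
        ((hCsmooth i j).pd i)
  have hflux_smooth : ∀ i, ContDiff ℝ (⊤ : ℕ∞)
      (fun y => (ρ y)⁻¹ * ∑ j, C y i j * pd j (fun z => ρ z * f z) y) := fun i =>
    (hρ_smooth.inv fun x => (hρ_pos x).ne').mul
      (ContDiff.sum fun j _ => (hCsmooth i j).mul ((hρ_smooth.mul hf).pd j))
  have hflux : ∀ i y, ∑ j, pd j (fun z => C z i j * f z) y
      = (ρ y)⁻¹ * (∑ j, C y i j * pd j (fun z => ρ z * f z) y) - κ i y * f y := by
    intro i y
    rw [hκ, Finset.mul_sum, Finset.sum_mul, ← Finset.sum_sub_distrib]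
    refine Finset.sum_congr rfl fun j _ => ?_
    have hC : (fun z => C z j i) = fun z => C z i j := funext fun z => hsymm z j i
    rw [pd_mul (diff (hCsmooth i j) y) (diff hf y), pd_mul (diff hρ_smooth y) (diff hf y),
      mul_div_assoc, ← hpdρ, hC, hsymm y j i]
    have := (hρ_pos y).ne'
    field_simp
    ring
  intro x
  rw [hΔhat, inv_mul_cancel_left₀ (hρ_pos x).ne', ← Finset.sum_sub_distrib]
  refine Finset.sum_congr rfl fun i _ => ?_
  rw [← pd_sub (diff (hflux_smooth i) x) (diff ((hκ_smooth i).mul hf) x), ← funext (hflux i)]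
  exact (pd_sum (fun j _ => diff (((hCsmooth i j).mul hf).pd j) x) i).symm
end
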